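/- arXiv:1805.12339 — 2 statements merged into one kernel-verified Lean document; each statement's English description precedes it below -/
import Mathlib

section
/- Let r ≥ 2, let L ⊆ F_∞^r be a strongly discrete 𝔽_q-subspace, let v ∈ F_∞^r with v ∉ L, and let ω ∈ K^r have coordinates linearly independent over F_∞. Then Lω := {xω : x ∈ L} is a strongly discrete 𝔽_q-subspace of K, the infinite product defining e_{Lω}(vω) converges, e_{Lω}(vω) ≠ 0, and E_{1,v+L}(ω) = e_{Lω}(vω)^{−1}, i.e. (Σ_{x∈v+L} (xω)^{−1})·e_{Lω}(vω) = 1. (Corollary 13.5.) -/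
open scoped BigOperators

/-- The pairing of a row vector `x` with a column vector `ω`: `xω = ∑ i, x i * ω i`. -/
noncomputable def rvPair {K : Type*} [Field K] {r : ℕ} (x ω : Fin r → K) : K :=
  ∑ i, x i * ω i

/-- A subset `M` of a seminormed additive group is strongly discrete if `M ∩ B` is finite
for every bounded subset `B`. -/
def StronglyDiscrete {E : Type*} [SeminormedAddCommGroup E] (M : Set E) : Prop :=
  ∀ B : Set E, Bornology.IsBounded B → (M ∩ B).Finite

/-- The coset `v + L`. -/
def cosetOf {G : Type*} [AddGroup G] (v : G) (L : Set G) : Set G := {x | x - v ∈ L}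

/-- The Eisenstein series value `E_k(S)(ω) = ∑_{x ∈ S, x ≠ 0} (xω)^{-k}`, for `S` a coset. -/
noncomputable def EisSet {K : Type*} [NormedField K] {r : ℕ} (k : ℕ) (S : Set (Fin r → K))
    (ω : Fin r → K) : K :=
  ∑' x : {x : Fin r → K // x ∈ S ∧ x ≠ 0}, ((rvPair (x : Fin r → K) ω) ^ k)⁻¹

/-- The exponential function `e_Λ(z) = z·∏_{λ ∈ Λ, λ ≠ 0} (1 - z/λ)` of a subset `Λ ⊆ K`. -/
noncomputable def expF {K : Type*} [NormedField K] (Λ : Set K) (z : K) : K :=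
  z * ∏' l : {l : K // l ∈ Λ ∧ l ≠ 0}, (1 - z / (l : K))

section FiniteSubgroup

variable {F : Type*} [Field F] [DecidableEq F] {G : AddSubgroup F} {s : Finset F}

theorem mul_prod_erase_one_sub_div (h0 : (0 : F) ∈ s) (w : F) :
    w * ∏ k ∈ s.erase 0, (1 - w / k) = (∏ k ∈ s, (w - k)) * ∏ k ∈ s.erase 0, (-k)⁻¹ := by
  rw [← Finset.mul_prod_erase s (fun k => w - k) h0, sub_zero, mul_assoc,
    ← Finset.prod_mul_distrib]
  congr 1
  refine Finset.prod_congr rfl fun k hk => ?_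
  have : k ≠ 0 := Finset.ne_of_mem_erase hk
  field_simp
  ring

theorem mul_prod_erase_one_sub_div_sub (hs : ∀ x, x ∈ s ↔ x ∈ G) (w : F) {g : F} (hg : g ∈ G) :
    (w - g) * ∏ k ∈ s.erase 0, (1 - (w - g) / k) = w * ∏ k ∈ s.erase 0, (1 - w / k) := by
  have h0 : (0 : F) ∈ s := (hs 0).2 G.zero_mem
  rw [mul_prod_erase_one_sub_div h0, mul_prod_erase_one_sub_div h0]
  congr 1
  refine Finset.prod_nbij' (fun k => g + k) (fun k => k - g) ?_ ?_ ?_ ?_ ?_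
  · intro k hk
    exact (hs _).2 (G.add_mem hg ((hs _).1 hk))
  · intro k hk
    exact (hs _).2 (G.sub_mem ((hs _).1 hk) hg)
  · intro k _
    ring
  · intro k _
    ring
  · intro k _
    ring

theorem sum_prod_erase_one_sub_div (hs : ∀ x, x ∈ s ↔ x ∈ G) (z : F) :
    ∑ g ∈ s, ∏ k ∈ s.erase 0, (1 - (z - g) / k) = 1 := by
  have h0 : (0 : F) ∈ s := (hs 0).2 G.zero_mem
  have h := congrArg (Polynomial.eval z)
    (Lagrange.sum_basis (v := (id : F → F)) (s := s) (Set.injOn_id _) ⟨0, h0⟩)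
  rw [Polynomial.eval_finsetSum, Polynomial.eval_one] at h
  refine Eq.trans (Finset.sum_congr rfl fun g hg => ?_) h
  clear h
  rw [Lagrange.basis, Polynomial.eval_prod]
  refine Finset.prod_nbij' (fun k => g + k) (fun k => k - g) ?_ ?_ ?_ ?_ ?_
  · intro k hk
    rw [Finset.mem_erase, hs] at hk ⊢
    exact ⟨by simpa using hk.1, G.add_mem ((hs _).1 hg) hk.2⟩
  · intro k hk
    rw [Finset.mem_erase, hs] at hk ⊢
    exact ⟨sub_ne_zero.2 hk.1, G.sub_mem hk.2 ((hs _).1 hg)⟩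
  · intro k _
    ring
  · intro k _
    ring
  · intro k hk
    have : k ≠ 0 := Finset.ne_of_mem_erase hk
    simp only [Lagrange.basisDivisor, id, Polynomial.eval_mul, Polynomial.eval_C,
      Polynomial.eval_sub, Polynomial.eval_X, sub_add_cancel_left]
    field_simp
    ring

/-- The logarithmic derivative of the exponential of a finite additive subgroup is its inverse. -/
theorem sum_inv_sub_mul_prod_eq_one (hs : ∀ x, x ∈ s ↔ x ∈ G) {z : F} (hz : z ∉ G) :
    (∑ g ∈ s, (z - g)⁻¹) * (z * ∏ k ∈ s.erase 0, (1 - z / k)) = 1 := by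
  rw [Finset.sum_mul]
  refine Eq.trans ?_ (sum_prod_erase_one_sub_div hs z)
  refine Finset.sum_congr rfl fun g hg => ?_
  have hg' := (hs g).1 hg
  have hne : z - g ≠ 0 := fun h => hz (sub_eq_zero.1 h ▸ hg')
  rw [← mul_prod_erase_one_sub_div_sub hs z hg', inv_mul_cancel_left₀ hne]

end FiniteSubgroup

section Ultrametric

open Filter Topology Bornology

variable {K : Type*} [NormedField K]

theorem tendsto_finset_prod_cofinite_zero {ι : Type*} {f : ι → K}
    (hf : Tendsto f cofinite (𝓝 0)) :
    Tendsto (fun s : Finset ι => ∏ i ∈ s, f i) cofinite (𝓝 0) := by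
  classical
  have hfin : ∀ ε : ℝ, 0 < ε → {i | ε ≤ ‖f i‖}.Finite := fun ε hε => by
    have h := (Metric.tendsto_nhds.1 hf) ε hε
    simpa [Filter.eventually_cofinite] using h
  set B := (hfin 1 one_pos).toFinset with hB
  set C : ℝ := ∏ i ∈ B, max 1 ‖f i‖ with hC
  have hg1 : ∀ i, 1 ≤ max 1 ‖f i‖ := fun i => le_max_left _ _
  have hC1 : 1 ≤ C := Finset.one_le_prod fun i _ => hg1 i
  have hbound : ∀ u : Finset ι, ∏ i ∈ u, ‖f i‖ ≤ C := fun u => calc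
    ∏ i ∈ u, ‖f i‖ ≤ ∏ i ∈ u, max 1 ‖f i‖ :=
      Finset.prod_le_prod (fun _ _ => norm_nonneg _) fun _ _ => le_max_right _ _
    _ ≤ ∏ i ∈ u ∪ B, max 1 ‖f i‖ := by
      rw [← Finset.prod_sdiff (Finset.subset_union_left : u ⊆ u ∪ B)]
      exact le_mul_of_one_le_left (Finset.prod_nonneg fun i _ => zero_le_one.trans (hg1 i))
        (Finset.one_le_prod fun i _ => hg1 i)
    _ = C := by
      refine (Finset.prod_subset Finset.subset_union_right fun i _ hi => ?_).symm
      have : ‖f i‖ < 1 := by simpa [hB] using hi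
      exact max_eq_left this.le
  rw [Metric.tendsto_nhds]
  intro ε hε
  have hδ : 0 < ε / C := by positivity
  rw [Filter.eventually_cofinite]
  refine (Finset.finite_toSet (hfin _ hδ).toFinset.powerset).subset fun s hs => ?_
  rw [Finset.mem_coe, Finset.mem_powerset]
  by_contra hsub
  obtain ⟨j, hj, hj'⟩ := Finset.not_subset.1 hsub
  have hj'' : ‖f j‖ < ε / C := by simpa using hj'
  refine hs ?_
  rw [dist_zero_right, norm_prod, ← Finset.mul_prod_erase s _ hj]
  calc ‖f j‖ * ∏ i ∈ s.erase j, ‖f i‖ ≤ ‖f j‖ * C := by gcongr; exact hbound _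
    _ < ε / C * C := by gcongr
    _ = ε := by field_simp

theorem multipliable_one_add_of_tendsto_cofinite_zero [IsUltrametricDist K] [CompleteSpace K]
    {ι : Type*} {f : ι → K} (hf : Tendsto f cofinite (𝓝 0)) :
    Multipliable fun i => 1 + f i :=
  multipliable_one_add_of_summable_prod
    (NonarchimedeanAddGroup.summable_of_tendsto_cofinite_zero
      (tendsto_finset_prod_cofinite_zero hf))

theorem StronglyDiscrete.tendsto_subtype_val {E : Type*} [SeminormedAddCommGroup E] {M : Set E}
    (hM : StronglyDiscrete M) {p : E → Prop} (hp : ∀ x, p x → x ∈ M) :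
    Tendsto (Subtype.val : {x // p x} → E) cofinite (cobounded E) := by
  intro U hU
  rw [← isCobounded_def, ← isBounded_compl_iff] at hU
  rw [mem_map, mem_cofinite]
  refine ((hM _ hU).preimage Subtype.val_injective.injOn).subset ?_
  intro x hx
  exact ⟨hp _ x.2, hx⟩

variable [IsUltrametricDist K] [CompleteSpace K]

theorem StronglyDiscrete.multipliable_one_sub_div {M : Set K} (hM : StronglyDiscrete M) (z : K) :
    Multipliable fun l : {l : K // l ∈ M ∧ l ≠ 0} => 1 - z / (l : K) := by
  have h : Tendsto (fun l : {l : K // l ∈ M ∧ l ≠ 0} => -(z * (l : K)⁻¹)) cofinite (𝓝 0) := by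
    simpa using ((tendsto_inv₀_cobounded.comp
      (hM.tendsto_subtype_val fun _ hx => hx.1)).const_mul z).neg
  simpa [sub_eq_add_neg, div_eq_mul_inv] using multipliable_one_add_of_tendsto_cofinite_zero h

theorem StronglyDiscrete.summable_inv_sub {M : Set K} (hM : StronglyDiscrete M) (z : K) :
    Summable fun l : {l : K // l ∈ M} => (z - (l : K))⁻¹ := by
  refine NonarchimedeanAddGroup.summable_of_tendsto_cofinite_zero
    (tendsto_inv₀_cobounded.comp ?_)
  exact (tendsto_const_sub_cobounded z).comp (hM.tendsto_subtype_val fun _ hx => hx)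

/-- The logarithmic derivative of the exponential of a strongly discrete additive subgroup is its
inverse. -/
theorem tsum_inv_sub_mul_expF (M : AddSubgroup K) (hM : StronglyDiscrete (M : Set K)) {z : K}
    (hz : z ∉ M) :
    (∑' l : {l : K // l ∈ (M : Set K)}, (z - (l : K))⁻¹) * expF (M : Set K) z = 1 := by
  classical
  let G : ℕ → AddSubgroup K := fun n =>
    { carrier := (M : Set K) ∩ Metric.closedBall 0 n
      zero_mem' := by simp
      add_mem' := fun {a b} ha hb => by
        simp only [Set.mem_inter_iff, SetLike.mem_coe, mem_closedBall_zero_iff] at ha hb ⊢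
        exact ⟨M.add_mem ha.1 hb.1, (IsUltrametricDist.norm_add_le_max a b).trans
          (max_le ha.2 hb.2)⟩
      neg_mem' := fun {a} ha => by
        simpa using ha }
  let T : ℕ → Finset K := fun n => (hM _ (Metric.isBounded_closedBall (x := 0) (r := n))).toFinset
  have hT : ∀ n x, x ∈ T n ↔ x ∈ G n := fun n x => Set.Finite.mem_toFinset _
  have hTM : ∀ n x, x ∈ T n ↔ x ∈ M ∧ ‖x‖ ≤ n := fun n x => by
    simp [T]
  have hmono : Monotone T := fun m n hmn x hx => by
    rw [hTM] at hx ⊢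
    exact ⟨hx.1, hx.2.trans (by exact_mod_cast hmn)⟩
  have hexh : ∀ x ∈ M, ∃ n, x ∈ T n := fun x hx => by
    obtain ⟨n, hn⟩ := exists_nat_ge ‖x‖
    exact ⟨n, (hTM n x).2 ⟨hx, hn⟩⟩
  have htend : ∀ (p : K → Prop) [DecidablePred p], (∀ x, p x → x ∈ M) →
      Tendsto (fun n => (T n).subtype p) atTop atTop := fun p _ hp => by
    refine tendsto_atTop_finset_of_monotone
      (fun m n hmn => Finset.subtype_mono (hmono hmn)) fun x => ?_
    obtain ⟨n, hn⟩ := hexh x (hp _ x.2)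
    exact ⟨n, Finset.mem_subtype.2 hn⟩
  have hsum := (hM.summable_inv_sub z).hasSum.comp (htend (· ∈ (M : Set K)) fun _ h => h)
  have hprod := (hM.multipliable_one_sub_div z).hasProd.comp
    (htend (fun l => l ∈ (M : Set K) ∧ l ≠ 0) fun _ h => h.1)
  have hlim := hsum.mul (hprod.const_mul z)
  refine tendsto_nhds_unique hlim (tendsto_const_nhds.congr fun n => Eq.symm ?_)
  have hzG : z ∉ G n := fun h => hz h.1
  refine Eq.trans ?_ (sum_inv_sub_mul_prod_eq_one (hT n) hzG)
  simp only [Function.comp_apply]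
  congr 1
  · exact (Finset.sum_subtype_of_mem (fun l => (z - l)⁻¹) fun x hx => ((hTM n x).1 hx).1)
  · congr 1
    rw [Finset.prod_subtype_eq_prod_filter (fun l => 1 - z / l)]
    refine Finset.prod_congr ?_ fun _ _ => rfl
    ext x
    simp only [Finset.mem_erase, Finset.mem_filter, SetLike.mem_coe]
    exact ⟨fun h => ⟨h.2.2, h.1⟩, fun h => ⟨h.2, ((hTM n x).1 h.2).1, h.1⟩⟩

end Ultrametric

section Pairing

variable {K : Type*} [NontriviallyNormedField K] {r : ℕ}

theorem rvPair_sub (x y ω : Fin r → K) : rvPair (x - y) ω = rvPair x ω - rvPair y ω := by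
  simp [rvPair, sub_mul, Finset.sum_sub_distrib]

/-- The pairing with `ω`, as an additive homomorphism. -/
noncomputable def rvPairHom (ω : Fin r → K) : (Fin r → K) →+ K :=
  AddMonoidHom.ofMapSub (fun x => rvPair x ω) fun x y => rvPair_sub x y ω

theorem exists_norm_le_mul_norm_rvPair [CompleteSpace K] (F : Subfield K)
    (hF : IsClosed (F : Set K)) (hnt : ∃ a ∈ F, 1 < ‖a‖) (ω : Fin r → K)
    (hω : ∀ x : Fin r → K, (∀ i, x i ∈ F) → rvPair x ω = 0 → x = 0) :
    ∃ C : ℝ, ∀ x : Fin r → K, (∀ i, x i ∈ F) → ‖x‖ ≤ C * ‖rvPair x ω‖ := by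
  let _ : NontriviallyNormedField F :=
    { (inferInstance : NormedField F) with
      non_trivial := by
        obtain ⟨a, ha, h1⟩ := hnt
        exact ⟨⟨a, ha⟩, h1⟩ }
  have : CompleteSpace F := hF.completeSpace_coe
  let _ : NormedSpace F K :=
    { (inferInstance : Module F K) with
      norm_smul_le := fun a b => (norm_mul (a : K) b).le }
  let f : (Fin r → F) →ₗ[F] K :=
    { toFun := fun x => rvPair (fun i => (x i : K)) ω
      map_add' := fun x y => by simp [rvPair, add_mul, Finset.sum_add_distrib]
      map_smul' := fun c x => by
        simp [rvPair, Finset.mul_sum, mul_assoc, Subfield.smul_def] }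
  have hker : LinearMap.ker f = ⊥ := by
    refine LinearMap.ker_eq_bot'.2 fun x hx => ?_
    have h := hω (fun i => (x i : K)) (fun i => (x i).2) hx
    funext i
    exact Subtype.ext (congrFun h i)
  obtain ⟨C, -, hC⟩ := f.exists_antilipschitzWith hker
  refine ⟨C, fun x hx => ?_⟩
  have h := hC.le_mul_dist (fun i => ⟨x i, hx i⟩) 0
  rw [map_zero, dist_zero_right, dist_zero_right] at h
  refine le_trans ((pi_norm_le_iff_of_nonneg (norm_nonneg _)).2 fun i => ?_) h
  exact norm_le_pi_norm (fun i => (⟨x i, hx i⟩ : F)) i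

theorem StronglyDiscrete.image_rvPair [CompleteSpace K] (F : Subfield K)
    (hF : IsClosed (F : Set K)) (ω : Fin r → K)
    (hω : ∀ x : Fin r → K, (∀ i, x i ∈ F) → rvPair x ω = 0 → x = 0)
    {L : Set (Fin r → K)} (hL : StronglyDiscrete L) (hLF : ∀ x ∈ L, ∀ i, x i ∈ F) :
    StronglyDiscrete ((fun x => rvPair x ω) '' L) := by
  intro B hB
  by_cases hnt : ∃ a ∈ F, 1 < ‖a‖
  · obtain ⟨C, hC⟩ := exists_norm_le_mul_norm_rvPair F hF hnt ω hω
    obtain ⟨R, hR⟩ := hB.exists_norm_le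
    refine ((hL _ (Metric.isBounded_closedBall (x := 0) (r := |C| * R))).image
      fun x => rvPair x ω).subset ?_
    rintro _ ⟨⟨x, hx, rfl⟩, hxB⟩
    refine ⟨x, ⟨hx, mem_closedBall_zero_iff.2 ?_⟩, rfl⟩
    calc ‖x‖ ≤ C * ‖rvPair x ω‖ := hC x (hLF x hx)
      _ ≤ |C| * ‖rvPair x ω‖ := by gcongr; exact le_abs_self C
      _ ≤ |C| * R := by gcongr; exact hR _ hxB
  · push Not at hnt
    have hfin : L.Finite := by
      refine (hL _ (Metric.isBounded_closedBall (x := 0) (r := 1))).subset fun x hx => ⟨hx, ?_⟩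
      exact mem_closedBall_zero_iff.2
        ((pi_norm_le_iff_of_nonneg zero_le_one).2 fun i => hnt _ (hLF x hx i))
    exact (hfin.image _).subset Set.inter_subset_left

theorem EisSet_one_cosetOf (F : Subfield K) (ω : Fin r → K)
    (hω : ∀ x : Fin r → K, (∀ i, x i ∈ F) → rvPair x ω = 0 → x = 0)
    (L : AddSubgroup (Fin r → K)) (hLF : ∀ x ∈ L, ∀ i, x i ∈ F)
    {v : Fin r → K} (hvL : v ∉ L) :
    EisSet 1 (cosetOf v (L : Set (Fin r → K))) ω =
      ∑' l : {l : K // l ∈ (L.map (rvPairHom ω) : Set K)}, (rvPair v ω - (l : K))⁻¹ := by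
  have hinj : ∀ x ∈ L, ∀ y ∈ L, rvPair x ω = rvPair y ω → x = y := fun x hx y hy h =>
    sub_eq_zero.1 (hω _ (fun i => F.sub_mem (hLF x hx i) (hLF y hy i))
      (by rw [rvPair_sub, h, sub_self]))
  let φ : {x : Fin r → K // x ∈ cosetOf v (L : Set (Fin r → K)) ∧ x ≠ 0} →
      {l : K // l ∈ (L.map (rvPairHom ω) : Set K)} := fun x =>
    ⟨rvPair (v - x.1) ω, v - x.1, by simpa using L.neg_mem x.2.1, rfl⟩
  have hφ : Function.Bijective φ := by
    constructor
    · intro x y h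
      have := hinj _ (by simpa using L.neg_mem x.2.1) _ (by simpa using L.neg_mem y.2.1)
        (congrArg Subtype.val h)
      exact Subtype.ext (sub_right_injective this)
    · rintro ⟨_, y, hy, rfl⟩
      refine ⟨⟨v - y, ?_, fun h => hvL (sub_eq_zero.1 h ▸ hy)⟩, Subtype.ext ?_⟩
      · simpa [cosetOf] using hy
      · simp [φ, rvPairHom]
  rw [← (Equiv.ofBijective φ hφ).tsum_eq]
  refine tsum_congr fun x => ?_
  rw [Equiv.ofBijective_apply, pow_one, ← rvPair_sub, sub_sub_cancel]

end Pairing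

/-- for `v ∉ L`, `Lω` is a strongly discrete `𝔽_q`-subspace of `K`, the
product defining `e_{Lω}(vω)` converges and is nonzero, and `E_{1,v+L}(ω) = e_{Lω}(vω)⁻¹`. -/
theorem eisenstein_weight_one
    (K : Type*) [NontriviallyNormedField K] [IsUltrametricDist K] [CompleteSpace K]
    [IsAlgClosed K]
    (Finf : Subfield K) (hFinfclosed : IsClosed (Finf : Set K))
    (hFinfloc : LocallyCompactSpace Finf)
    (Fq : Subfield K) (hFqfin : Finite Fq) (q : ℕ) (hq : Nat.card Fq = q)
    (hFqFinf : Fq ≤ Finf)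
    (r : ℕ) (hr : 2 ≤ r)
    (L : AddSubgroup (Fin r → K)) (hLF : ∀ x ∈ L, ∀ i, x i ∈ Finf)
    (hLdisc : StronglyDiscrete (L : Set (Fin r → K)))
    (hLFq : ∀ c ∈ Fq, ∀ x ∈ L, (fun i => c * x i) ∈ L)
    (v : Fin r → K) (hv : ∀ i, v i ∈ Finf) (hvL : v ∉ L)
    (ω : Fin r → K)
    (hω : ∀ x : Fin r → K, (∀ i, x i ∈ Finf) → rvPair x ω = 0 → x = 0) :
    (∃ M : AddSubgroup K,
        (M : Set K) = (fun x => rvPair x ω) '' (L : Set (Fin r → K))) ∧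
    (∀ c ∈ Fq, ∀ z ∈ (fun x => rvPair x ω) '' (L : Set (Fin r → K)),
        c * z ∈ (fun x => rvPair x ω) '' (L : Set (Fin r → K))) ∧
    StronglyDiscrete ((fun x => rvPair x ω) '' (L : Set (Fin r → K))) ∧
    Multipliable (fun l : {l : K //
        l ∈ (fun x => rvPair x ω) '' (L : Set (Fin r → K)) ∧ l ≠ 0} =>
      1 - rvPair v ω / (l : K)) ∧
    expF ((fun x => rvPair x ω) '' (L : Set (Fin r → K))) (rvPair v ω) ≠ 0 ∧
    EisSet 1 (cosetOf v (L : Set (Fin r → K))) ω *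
        expF ((fun x => rvPair x ω) '' (L : Set (Fin r → K))) (rvPair v ω) = 1 := by
  have hM : ((L.map (rvPairHom ω) : AddSubgroup K) : Set K) =
      (fun x => rvPair x ω) '' (L : Set (Fin r → K)) := rfl
  have hdisc := hLdisc.image_rvPair Finf hFinfclosed ω hω hLF
  have hvM : rvPair v ω ∉ L.map (rvPairHom ω) := by
    rintro ⟨x, hx, hxv⟩
    have h : v - x = 0 := hω _ (fun i => Finf.sub_mem (hv i) (hLF x hx i))
      (by rw [rvPair_sub, sub_eq_zero]; exact hxv.symm)
    exact hvL (sub_eq_zero.1 h ▸ hx)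
  have hone : EisSet 1 (cosetOf v (L : Set (Fin r → K))) ω *
      expF ((fun x => rvPair x ω) '' (L : Set (Fin r → K))) (rvPair v ω) = 1 := by
    rw [EisSet_one_cosetOf Finf ω hω L hLF hvL]
    exact tsum_inv_sub_mul_expF _ hdisc hvM
  refine ⟨⟨_, hM⟩, ?_, hdisc, hdisc.multipliable_one_sub_div _,
    right_ne_zero_of_mul_eq_one hone, hone⟩
  rintro c hc _ ⟨x, hx, rfl⟩
  exact ⟨_, hLFq c hc x hx, by simp [rvPair, Finset.mul_sum, mul_assoc]⟩
end

section
/- For every γ ∈ Γ′ and every nonzero prime ideal p of A, the image of γ in GL_r(F_p) lies in K′_p and the right coset K_pγ depends only on the left coset Γγ; moreover the resulting map Γ∖Γ′ → ∏_p K_p∖K′_p, Γγ ↦ (K_pγ)_p (product over all nonzero primes p of A), is a bijection. (Lemma 14.3.) -/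
open scoped BigOperators
open IsDedekindDomain

/-- The stabilizer condition of a set of row vectors under right multiplication. -/
def StabSet {Q : Type*} [Field Q] {r : ℕ} (S : Set (Fin r → Q)) (k : GL (Fin r) Q) : Prop :=
  (fun x => Matrix.vecMul x (k : Matrix (Fin r) (Fin r) Q)) '' S = S

section

variable (R₀ : Type*) [CommRing R₀] [IsDomain R₀] [IsDedekindDomain R₀]
  (F : Type*) [Field F] [Algebra R₀ F] [IsFractionRing R₀ F]

/-- The embedding of a vector of `F^r` into `F_p^r`. -/
noncomputable def embVec (p : HeightOneSpectrum R₀) {r : ℕ} (x : Fin r → F) :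
    Fin r → p.adicCompletion F :=
  fun i => algebraMap F (p.adicCompletion F) (x i)

/-- `M_p`: the topological closure of the image of `M ⊆ F^r` in `F_p^r`. -/
noncomputable def locCl (p : HeightOneSpectrum R₀) {r : ℕ} (M : Set (Fin r → F)) :
    Set (Fin r → p.adicCompletion F) :=
  closure ((fun x => embVec R₀ F p x) '' M)

/-- `𝔪_p·S`: the additive group generated by the products of elements of the maximal
ideal of the valuation ring of `F_p` with elements of `S`. -/
def mIdealSMul (p : HeightOneSpectrum R₀) {r : ℕ}
    (S : Set (Fin r → p.adicCompletion F)) : Set (Fin r → p.adicCompletion F) :=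
  (AddSubgroup.closure {y | ∃ c : p.adicCompletion F,
    Valued.v c < (1 : WithZero (Multiplicative ℤ)) ∧ ∃ x ∈ S, y = fun i => c * x i} :
    AddSubgroup (Fin r → p.adicCompletion F))

/-- The entrywise embedding `GL_r(F) → GL_r(F_p)`. -/
noncomputable def embGL (p : HeightOneSpectrum R₀) {r : ℕ} (γ : GL (Fin r) F) :
    GL (Fin r) (p.adicCompletion F) :=
  Units.map ((algebraMap F (p.adicCompletion F)).mapMatrix.toMonoidHom) γ

end


open Matrix Topology

section Stabilizer

variable {Q : Type*} [Field Q] {r : ℕ} {S : Set (Fin r → Q)}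

lemma vecMul_inv_vecMul (k : GL (Fin r) Q) (x : Fin r → Q) :
    (x ᵥ* (k⁻¹ : GL (Fin r) Q).1) ᵥ* k.1 = x := by
  rw [vecMul_vecMul, ← Units.val_mul, inv_mul_cancel, Units.val_one, vecMul_one]

lemma vecMul_vecMul_inv (k : GL (Fin r) Q) (x : Fin r → Q) :
    (x ᵥ* k.1) ᵥ* (k⁻¹ : GL (Fin r) Q).1 = x := by
  rw [vecMul_vecMul, ← Units.val_mul, mul_inv_cancel, Units.val_one, vecMul_one]

lemma stabSet_iff {k : GL (Fin r) Q} : StabSet S k ↔ ∀ x, x ᵥ* k.1 ∈ S ↔ x ∈ S := by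
  constructor
  · intro h x
    constructor
    · intro hx
      rw [← h] at hx
      obtain ⟨y, hy, hxy⟩ := hx
      have := congrArg (fun z => z ᵥ* (k⁻¹ : GL (Fin r) Q).1) hxy
      simp only [vecMul_vecMul_inv] at this
      rwa [← this]
    · intro hx
      rw [← h]
      exact ⟨x, hx, rfl⟩
  · intro h
    ext x
    constructor
    · rintro ⟨y, hy, rfl⟩
      exact (h y).2 hy
    · intro hx
      exact ⟨_, (h _).1 (by rwa [vecMul_inv_vecMul]), vecMul_inv_vecMul k x⟩

lemma StabSet.mul {k l : GL (Fin r) Q} (hk : StabSet S k) (hl : StabSet S l) :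
    StabSet S (k * l) := by
  rw [stabSet_iff] at *
  intro x
  rw [Units.val_mul, ← vecMul_vecMul, hl, hk]

lemma StabSet.inv {k : GL (Fin r) Q} (hk : StabSet S k) : StabSet S k⁻¹ := by
  rw [stabSet_iff] at *
  intro x
  rw [← hk, vecMul_inv_vecMul]

lemma stabSet_of_forall_mem {k : GL (Fin r) Q} (h : ∀ x ∈ S, x ᵥ* k.1 ∈ S)
    (h' : ∀ x ∈ S, x ᵥ* (k⁻¹ : GL (Fin r) Q).1 ∈ S) : StabSet S k :=
  stabSet_iff.2 fun x => ⟨fun hx => by simpa only [vecMul_vecMul_inv] using h' _ hx, h x⟩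

/-- Right multiplication by an invertible matrix as a homeomorphism of row vectors. -/
def vecMulHomeomorph [TopologicalSpace Q] [IsTopologicalRing Q] (k : GL (Fin r) Q) :
    (Fin r → Q) ≃ₜ (Fin r → Q) where
  toFun x := x ᵥ* k.1
  invFun x := x ᵥ* (k⁻¹ : GL (Fin r) Q).1
  left_inv := vecMul_vecMul_inv k
  right_inv := vecMul_inv_vecMul k
  continuous_toFun := by fun_prop
  continuous_invFun := by fun_prop

lemma cosetOf_eq_image {G : Type*} [AddGroup G] (v : G) (M : Set G) :
    cosetOf v M = (fun x => x + v) '' M := by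
  ext x
  simp [cosetOf, sub_eq_add_neg]

lemma image_vecMul_cosetOf (k : GL (Fin r) Q) (v : Fin r → Q) :
    (fun x => x ᵥ* k.1) '' cosetOf v S = cosetOf (v ᵥ* k.1) ((fun x => x ᵥ* k.1) '' S) := by
  ext x
  constructor
  · rintro ⟨y, hy, rfl⟩
    exact ⟨y - v, hy, sub_vecMul _ _ _⟩
  · rintro ⟨y, hy, hxy⟩
    refine ⟨y + v, by simpa [cosetOf] using hy, ?_⟩
    simp only [add_vecMul] at hxy ⊢
    rw [hxy, sub_add_cancel]

end Stabilizer

section Completion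

variable {A : Type*} [CommRing A] [IsDedekindDomain A]
  {F : Type*} [Field F] [Algebra A F] [IsFractionRing A F] (p : HeightOneSpectrum A) {r : ℕ}

lemma valued_algebraMap (x : F) :
    Valued.v (algebraMap F (p.adicCompletion F) x) = p.valuation F x :=
  HeightOneSpectrum.valuedAdicCompletion_eq_valuation' p x

lemma embGL_mul (γ γ' : GL (Fin r) F) :
    embGL A F p (γ * γ') = embGL A F p γ * embGL A F p γ' := map_mul _ _ _

lemma embGL_inv (γ : GL (Fin r) F) : embGL A F p γ⁻¹ = (embGL A F p γ)⁻¹ := map_inv _ _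

lemma embVec_vecMul (x : Fin r → F) (γ : GL (Fin r) F) :
    embVec A F p (x ᵥ* γ.1) = embVec A F p x ᵥ* (embGL A F p γ).1 :=
  funext fun i => RingHom.map_vecMul (algebraMap F (p.adicCompletion F)) γ.1 x i

lemma embVec_add (x y : Fin r → F) :
    embVec A F p (x + y) = embVec A F p x + embVec A F p y := by
  ext i; simp [embVec]

lemma embVec_sub (x y : Fin r → F) :
    embVec A F p (x - y) = embVec A F p x - embVec A F p y := by
  ext i; simp [embVec]

lemma locCl_image_vecMul (M : Set (Fin r → F)) (γ : GL (Fin r) F) :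
    locCl A F p ((fun x => x ᵥ* γ.1) '' M) =
      (fun x => x ᵥ* (embGL A F p γ).1) '' locCl A F p M := by
  rw [locCl, locCl]
  refine Eq.trans ?_ ((vecMulHomeomorph (embGL A F p γ)).image_closure _).symm
  rw [Set.image_image, Set.image_image]
  simp only [embVec_vecMul]
  rfl

lemma locCl_cosetOf (v : Fin r → F) (M : Set (Fin r → F)) :
    locCl A F p (cosetOf v M) = cosetOf (embVec A F p v) (locCl A F p M) := by
  rw [cosetOf_eq_image, cosetOf_eq_image, locCl, locCl]
  refine Eq.trans ?_ ((Homeomorph.addRight (embVec A F p v)).image_closure _).symm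
  rw [Set.image_image, Set.image_image]
  simp only [embVec_add]
  rfl

lemma StabSet.locCl {S : Set (Fin r → F)} {γ : GL (Fin r) F} (h : StabSet S γ) :
    StabSet (locCl A F p S) (embGL A F p γ) := by
  rw [StabSet, ← locCl_image_vecMul, h]

end Completion

section Lattice

variable {A : Type*} [CommRing A] [IsDedekindDomain A]
  {F : Type*} [Field F] [Algebra A F] [IsFractionRing A F] {r : ℕ}

lemma exists_ne_zero_smul_mem {L : Submodule A (Fin r → F)}
    (hL : Submodule.span F (L : Set (Fin r → F)) = ⊤) (x : Fin r → F) :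
    ∃ d : A, d ≠ 0 ∧ d • x ∈ L := by
  have hx : x ∈ Submodule.span F (L : Set (Fin r → F)) := hL ▸ Submodule.mem_top
  induction hx using Submodule.span_induction with
  | mem x hx => exact ⟨1, one_ne_zero, by simpa using hx⟩
  | zero => exact ⟨1, one_ne_zero, by simp⟩
  | add x y _ _ hx hy =>
    obtain ⟨d, hd, hdx⟩ := hx
    obtain ⟨e, he, hey⟩ := hy
    refine ⟨d * e, mul_ne_zero hd he, ?_⟩
    rw [smul_add]
    refine L.add_mem ?_ ?_
    · rw [mul_comm, mul_smul]
      exact L.smul_mem _ hdx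
    · rw [mul_smul]
      exact L.smul_mem _ hey
  | smul c x _ hx =>
    obtain ⟨d, hd, hdx⟩ := hx
    obtain ⟨n, m, hm, rfl⟩ := IsFractionRing.div_surjective (A := A) c
    refine ⟨d * m, mul_ne_zero hd (nonZeroDivisors.ne_zero hm), ?_⟩
    have : (d * m) • (algebraMap A F n / algebraMap A F m) • x = n • d • x := by
      have hm' : algebraMap A F m ≠ 0 :=
        IsFractionRing.to_map_ne_zero_of_mem_nonZeroDivisors hm
      ext i
      simp only [Pi.smul_apply]
      simp only [Algebra.smul_def, map_mul, Algebra.algebraMap_self_apply]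
      field_simp
    rw [this]
    exact L.smul_mem _ hdx

variable (p : HeightOneSpectrum A)

/-- The rows of `g` form a basis of the localization of `L` at `p`. -/
structure IsLocBasis (L : Submodule A (Fin r → F)) (g : GL (Fin r) F) : Prop where
  valuation_le : ∀ x ∈ L, ∀ i, p.valuation F ((x ᵥ* (g⁻¹ : GL (Fin r) F).1) i) ≤ 1
  exists_smul_mem : ∀ i, ∃ s, s ∉ p.asIdeal ∧ s • g.1.row i ∈ L

variable {p}

lemma exists_smul_mem_of_mem_span {L : Submodule A (Fin r → F)} {x : Fin r → F}
    (hx : x ∈ Submodule.span (p.valuation F).valuationSubring (L : Set (Fin r → F))) :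
    ∃ s, s ∉ p.asIdeal ∧ s • x ∈ L := by
  have hp := p.isPrime
  induction hx using Submodule.span_induction with
  | mem x hx => exact ⟨1, p.asIdeal.one_notMem, by simpa using hx⟩
  | zero => exact ⟨1, p.asIdeal.one_notMem, by simp⟩
  | add x y _ _ hx hy =>
    obtain ⟨d, hd, hdx⟩ := hx
    obtain ⟨e, he, hey⟩ := hy
    refine ⟨d * e, fun h => (hp.mem_or_mem h).elim hd he, ?_⟩
    rw [smul_add]
    refine L.add_mem ?_ ?_
    · rw [mul_comm, mul_smul]
      exact L.smul_mem _ hdx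
    · rw [mul_smul]
      exact L.smul_mem _ hey
  | smul c x _ hx =>
    obtain ⟨d, hd, hdx⟩ := hx
    obtain ⟨n, m, hm⟩ := p.exists_primeCompl_mul_eq_of_integer (c : F) c.2
    refine ⟨d * m, fun h => (hp.mem_or_mem h).elim hd m.2, ?_⟩
    have : (d * m : A) • c • x = n • d • x := by
      ext i
      simp only [Pi.smul_apply]
      simp only [Algebra.smul_def, map_mul, ← hm]
      change _ * _ * ((c : F) * _) = _
      ring
    rw [this]
    exact L.smul_mem _ hdx

variable (p) in
lemma exists_isLocBasis {L : Submodule A (Fin r → F)} (hfg : L.FG)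
    (hL : Submodule.span F (L : Set (Fin r → F)) = ⊤) : ∃ g : GL (Fin r) F, IsLocBasis p L g := by
  let R := (p.valuation F).valuationSubring
  let N : Submodule R (Fin r → F) := Submodule.span R (L : Set (Fin r → F))
  have hN : N.IsLattice F := by
    refine ⟨?_, ?_⟩
    · obtain ⟨s, hs⟩ := hfg
      refine ⟨s, le_antisymm (Submodule.span_mono (hs ▸ Submodule.subset_span)) ?_⟩
      refine Submodule.span_le.2 fun x hx => ?_
      have hx' : x ∈ Submodule.span A (s : Set (Fin r → F)) := hs ▸ hx
      clear hx
      induction hx' using Submodule.span_induction with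
      | mem x hx => exact Submodule.subset_span hx
      | zero => exact Submodule.zero_mem _
      | add x y _ _ hx hy => exact Submodule.add_mem _ hx hy
      | smul c x _ hx =>
        have : c • x = (⟨algebraMap A F c, p.valuation_le_one c⟩ : R) • x := by
          ext i
          simp only [Pi.smul_apply]
          rw [Algebra.smul_def]
          rfl
        rw [this]
        exact Submodule.smul_mem _ _ hx
    · exact top_le_iff.1 (hL ▸ Submodule.span_mono Submodule.subset_span)
  have : IsDiscreteValuationRing R := inferInstance
  have hr : Module.finrank R N = r := by
    rw [Submodule.IsLattice.finrank_of_pi (K := F), Fintype.card_fin]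
  let b := Module.finBasisOfFinrankEq R N hr
  let B := b.extendOfIsLattice F
  have hB : IsUnit (Matrix.of B) :=
    Matrix.linearIndependent_rows_iff_isUnit.1 B.linearIndependent
  refine ⟨hB.unit, fun x hx i => ?_, fun i => ?_⟩
  · have hx' : x ∈ N := Submodule.subset_span hx
    have : x = (fun j => (b.repr ⟨x, hx'⟩ j : F)) ᵥ* hB.unit.1 := by
      have h := congrArg Subtype.val (b.sum_repr ⟨x, hx'⟩)
      ext i
      refine (congrFun h i).symm.trans ?_
      simp only [vecMul, dotProduct, IsUnit.unit_spec, of_apply, B,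
        Module.Basis.extendOfIsLattice_apply, Submodule.coe_sum, Finset.sum_apply]
      rfl
    rw [this, vecMul_vecMul_inv]
    exact (b.repr ⟨x, hx'⟩ i).2
  · refine exists_smul_mem_of_mem_span ?_
    have : hB.unit.1.row i = b i := b.extendOfIsLattice_apply F i
    rw [this]
    exact (b i).2

end Lattice

lemma finite_setOf_mem_asIdeal {A : Type*} [CommRing A] [IsDedekindDomain A] {d : A}
    (hd : d ≠ 0) : {p : HeightOneSpectrum A | d ∈ p.asIdeal}.Finite :=
  (Ideal.finite_factors (I := Ideal.span {d}) (by simpa using hd)).subset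
    fun _ hp => Ideal.dvd_span_singleton.2 hp

section Approximation

variable {A : Type*} [CommRing A] [IsDedekindDomain A]
  {F : Type*} [Field F] [Algebra A F] [IsFractionRing A F] {p : HeightOneSpectrum A}

open WithZero in
lemma exists_forall_valued_sub_le_mem {x : p.adicCompletion F} {U : Set (p.adicCompletion F)}
    (hU : U ∈ 𝓝 x) : ∃ n : ℕ, ∀ y, Valued.v (y - x) ≤ exp (-(n : ℤ)) → y ∈ U := by
  obtain ⟨γ, hγ⟩ := Valued.mem_nhds.1 hU
  have hγ0 : MonoidWithZeroHom.ValueGroup₀.embedding γ.1 ≠ 0 := by simp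
  obtain ⟨n, -, hn⟩ := exists_exp_neg_natCast_lt_and_lt hγ0 hγ0
  refine ⟨n, fun y hy => hγ ?_⟩
  exact (Valuation.restrict_lt_iff_lt_embedding _).2 (hy.trans_lt hn)

open WithZero in
lemma setOf_valued_sub_le_mem_nhds (x : p.adicCompletion F) (n : ℕ) :
    {y | Valued.v (y - x) ≤ exp (-(n : ℤ))} ∈ 𝓝 x := by
  obtain ⟨z, hz⟩ := p.valuedAdicCompletion_surjective F (exp (-(n : ℤ)))
  have hz0 : Valued.v.restrict z ≠ 0 := by
    rw [Valuation.ne_zero_iff]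
    rintro rfl
    rw [map_zero] at hz
    exact exp_ne_zero hz.symm
  refine Valued.mem_nhds.2 ⟨Units.mk0 _ hz0, fun y hy => ?_⟩
  rw [← hz]
  exact (Valued.v.restrict_lt_iff.1 hy).le

lemma isOpen_setOf_valued_le_one : IsOpen {x : p.adicCompletion F | Valued.v x ≤ 1} :=
  Valued.isOpen_valuationSubring (p.adicCompletion F)

lemma isClosed_setOf_valued_le_one : IsClosed {x : p.adicCompletion F | Valued.v x ≤ 1} :=
  Valued.isClosed_valuationSubring (p.adicCompletion F)

open WithZero in
lemma exists_valued_algebraMap_sub_le (x : p.adicCompletion F) (n : ℕ) :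
    ∃ f : F, Valued.v (algebraMap F (p.adicCompletion F) f - x) ≤ exp (-(n : ℤ)) := by
  obtain ⟨_, h, f, rfl⟩ := mem_closure_iff_nhds.1 (p.denseRange_algebraMap F x) _
    (setOf_valued_sub_le_mem_nhds x n)
  exact ⟨f, h⟩

lemma valued_le_one_of_sub {x y : p.adicCompletion F} (h : Valued.v (x - y) ≤ 1)
    (hy : Valued.v y ≤ 1) : Valued.v x ≤ 1 := by
  simpa using Valued.v.map_add_le h hy

open WithZero in
lemma exp_neg_natCast_le_one (n : ℕ) : exp (-(n : ℤ)) ≤ 1 := by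
  rw [← exp_zero, exp_le_exp]
  simp

open WithZero in
/-- Simultaneous approximation of local integers by a global integer. -/
lemma exists_forall_valued_sub_le_of_le_one (s : Finset (HeightOneSpectrum A))
    (x : ∀ p : HeightOneSpectrum A, p.adicCompletion F) (n : HeightOneSpectrum A → ℕ)
    (hx : ∀ p ∈ s, Valued.v (x p) ≤ 1) :
    ∃ a : A, ∀ p ∈ s, Valued.v (algebraMap F (p.adicCompletion F) (algebraMap A F a) - x p) ≤
      exp (-(n p : ℤ)) := by
  have h1 : ∀ p ∈ s, ∃ b : A,
      Valued.v (algebraMap F (p.adicCompletion F) (algebraMap A F b) - x p) ≤ exp (-(n p : ℤ)) := by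
    intro p hp
    obtain ⟨f, hf⟩ := exists_valued_algebraMap_sub_le (x p) (n p)
    have hf1 : p.valuation F f ≤ 1 := by
      rw [← valued_algebraMap]
      exact valued_le_one_of_sub (hf.trans (exp_neg_natCast_le_one _)) (hx p hp)
    obtain ⟨b, hb⟩ := p.exists_valuation_sub_lt_of_integer hf1
      (Units.mk0 (exp (-(n p : ℤ))) exp_ne_zero)
    refine ⟨b, ?_⟩
    rw [← valued_algebraMap, map_sub] at hb
    simpa using Valued.v.map_add_le hb.le hf
  choose! b hb using h1
  obtain ⟨a, ha⟩ := exists_forall_sub_mem_ideal (s := s) (fun p : HeightOneSpectrum A => p.asIdeal)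
    n (fun p _ => p.prime) (fun p _ q _ hpq h => hpq (HeightOneSpectrum.ext h)) (fun p => b p)
  refine ⟨a, fun p hp => ?_⟩
  have h2 : p.valuation F (algebraMap A F (a - b p)) ≤ exp (-(n p : ℤ)) :=
    (p.valuation_of_algebraMap _).trans_le ((p.intValuation_le_pow_iff_mem _ _).2 (ha p hp))
  rw [← valued_algebraMap, map_sub, map_sub] at h2
  simpa using Valued.v.map_add_le h2 (hb p hp)

open WithZero in
/-- Strong approximation for the additive group. -/
lemma exists_mem_and_valuation_le_one (s : Finset (HeightOneSpectrum A))
    (x : ∀ p : HeightOneSpectrum A, p.adicCompletion F)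
    (U : ∀ p : HeightOneSpectrum A, Set (p.adicCompletion F)) (hU : ∀ p ∈ s, U p ∈ 𝓝 (x p)) :
    ∃ f : F, (∀ p ∈ s, algebraMap F (p.adicCompletion F) f ∈ U p) ∧
      ∀ p ∉ s, p.valuation F f ≤ 1 := by
  classical
  choose! n hn using fun p hp => exists_forall_valued_sub_le_mem (hU p hp)
  choose f hf using fun p => exists_valued_algebraMap_sub_le (x p) (n p)
  obtain ⟨⟨d, hd⟩, hb⟩ := IsLocalization.exist_integer_multiples (nonZeroDivisors A) s f
  have hd0 : d ≠ 0 := nonZeroDivisors.ne_zero hd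
  have hdF : algebraMap A F d ≠ 0 := IsFractionRing.to_map_ne_zero_of_mem_nonZeroDivisors hd
  choose! b hb using hb
  have hfin := finite_setOf_mem_asIdeal hd0
  let t := s ∪ hfin.toFinset
  have hk : ∀ p : HeightOneSpectrum A, ∃ k : ℕ, exp (-(k : ℤ)) ≤ p.valuation F (algebraMap A F d) :=
    fun p => (exists_exp_neg_natCast_lt ((Valuation.ne_zero_iff _).2 hdF)).imp fun k hk => hk.le
  choose k hk using hk
  have hkn : ∀ p, exp (-((n p + k p : ℕ) : ℤ)) ≤
      exp (-(n p : ℤ)) * Valued.v (algebraMap F (p.adicCompletion F) (algebraMap A F d)) := by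
    intro p
    rw [valued_algebraMap, Nat.cast_add, neg_add, exp_add]
    gcongr
    exact hk p
  obtain ⟨a, ha⟩ := exists_forall_valued_sub_le_of_le_one t
    (fun p => if p ∈ s then algebraMap F (p.adicCompletion F) (algebraMap A F (b p)) else 0)
    (fun p => n p + k p) (fun p _ => by
      split_ifs
      · rw [valued_algebraMap]
        exact p.valuation_le_one _
      · simp)
  refine ⟨algebraMap A F a / algebraMap A F d, fun p hp => hn p hp _ ?_, fun p hp => ?_⟩
  · have h1 := ha p (Finset.mem_union_left _ hp)
    rw [if_pos hp, hb p hp, Algebra.smul_def, map_mul] at h1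
    have h2 := h1.trans (hkn p)
    have hd1 : algebraMap F (p.adicCompletion F) (algebraMap A F d) ≠ 0 := by simpa using hdF
    have h3 : algebraMap F (p.adicCompletion F) (algebraMap A F a) -
        algebraMap F (p.adicCompletion F) (algebraMap A F d) *
          algebraMap F (p.adicCompletion F) (f p) =
        (algebraMap F (p.adicCompletion F) (algebraMap A F a / algebraMap A F d) -
          algebraMap F (p.adicCompletion F) (f p)) *
          algebraMap F (p.adicCompletion F) (algebraMap A F d) := by
      rw [map_div₀]
      field_simp
    rw [h3, map_mul] at h2
    have h4 := le_of_mul_le_mul_right h2 (zero_lt_iff.2 ((Valuation.ne_zero_iff _).2 hd1))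
    simpa using Valued.v.map_add_le h4 (hf p)
  · rw [map_div₀]
    refine div_le_one_of_le₀ ?_ zero_le
    by_cases hpd : d ∈ p.asIdeal
    · have h1 := ha p (Finset.mem_union_right _ (by simpa using hpd))
      rw [if_neg hp, sub_zero, valued_algebraMap] at h1
      refine (h1.trans (hkn p)).trans ?_
      rw [valued_algebraMap]
      exact mul_le_of_le_one_left' (exp_neg_natCast_le_one _)
    · have : p.valuation F (algebraMap A F d) = 1 :=
        le_antisymm (p.valuation_le_one _)
          (not_lt.1 fun h => hpd ((p.valuation_lt_one_iff_mem _).1 h))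
      rw [this]
      exact p.valuation_le_one _

end Approximation

section LocalGlobal

variable {A : Type*} [CommRing A] [IsDedekindDomain A]
  {F : Type*} [Field F] [Algebra A F] [IsFractionRing A F] {p : HeightOneSpectrum A} {r : ℕ}
  {L : Submodule A (Fin r → F)}

lemma mem_closure_range_of_valued_le_one {x : p.adicCompletion F} (hx : Valued.v x ≤ 1) :
    x ∈ closure (Set.range fun a : A => algebraMap F (p.adicCompletion F) (algebraMap A F a)) := by
  classical
  rw [mem_closure_iff_nhds]
  intro U hU
  obtain ⟨n, hn⟩ := exists_forall_valued_sub_le_mem hU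
  obtain ⟨a, ha⟩ := exists_forall_valued_sub_le_of_le_one {p}
    (Function.update 0 p x) (fun _ => n) (by simpa using hx)
  exact ⟨_, hn _ (by simpa using ha), a, rfl⟩

lemma valuation_eq_one_of_notMem {s : A} (hs : s ∉ p.asIdeal) :
    p.valuation F (algebraMap A F s) = 1 :=
  le_antisymm (p.valuation_le_one _) (not_lt.1 fun h => hs ((p.valuation_lt_one_iff_mem _).1 h))

lemma IsLocBasis.mem_locCl_iff {g : GL (Fin r) F} (hg : IsLocBasis p L g)
    {y : Fin r → p.adicCompletion F} :
    y ∈ locCl A F p (L : Set (Fin r → F)) ↔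
      ∀ i, Valued.v ((y ᵥ* ((embGL A F p g)⁻¹ : GL (Fin r) (p.adicCompletion F)).1) i) ≤ 1 := by
  constructor
  · intro hy
    have hcl : IsClosed {y : Fin r → p.adicCompletion F | ∀ i,
        Valued.v ((y ᵥ* ((embGL A F p g)⁻¹ : GL (Fin r) (p.adicCompletion F)).1) i) ≤ 1} := by
      rw [Set.ofPred_forall]
      refine isClosed_iInter fun i => ?_
      exact isClosed_setOf_valued_le_one.preimage
        ((continuous_apply i).comp (vecMulHomeomorph (embGL A F p g)⁻¹).continuous)
    refine closure_minimal ?_ hcl hy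
    rintro _ ⟨x, hx, rfl⟩ i
    rw [← embGL_inv, ← embVec_vecMul, embVec, valued_algebraMap]
    exact hg.valuation_le x hx i
  · intro hy
    choose s hs hsL using hg.exists_smul_mem
    set c := y ᵥ* ((embGL A F p g)⁻¹ : GL (Fin r) (p.adicCompletion F)).1 with hc
    let T : (Fin r → p.adicCompletion F) → Fin r → p.adicCompletion F := fun a =>
      ∑ i, a i • embVec A F p (s i • g.1.row i)
    have hT : Continuous T := by fun_prop
    let e : A → p.adicCompletion F := fun a => algebraMap F (p.adicCompletion F) (algebraMap A F a)
    have hs1 : ∀ i, Valued.v (e (s i)) = 1 := fun i => by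
      rw [valued_algebraMap, valuation_eq_one_of_notMem (hs i)]
    have hs0 : ∀ i, e (s i) ≠ 0 := fun i h => by simpa [h] using hs1 i
    have hyT : y = T fun i => c i / e (s i) := by
      have : y = c ᵥ* (embGL A F p g).1 := by rw [hc, vecMul_inv_vecMul]
      rw [this]
      funext j
      simp only [vecMul, dotProduct, T, Finset.sum_apply, Pi.smul_apply, smul_eq_mul, embVec]
      refine Finset.sum_congr rfl fun i _ => ?_
      rw [Algebra.smul_def, map_mul, ← mul_assoc, div_mul_cancel₀ _ (hs0 i)]
      rfl
    have hmem : (fun i => c i / e (s i)) ∈ closure (Set.univ.pi fun _ : Fin r => Set.range e) := by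
      rw [closure_pi_set]
      intro i _
      refine mem_closure_range_of_valued_le_one ?_
      rw [map_div₀, hs1, div_one]
      exact hy i
    rw [hyT]
    refine map_mem_closure hT hmem fun a ha => ?_
    choose b hb using fun i => ha i trivial
    refine ⟨∑ i, b i • s i • g.1.row i, L.sum_mem fun i _ => L.smul_mem _ (hsL i), ?_⟩
    funext j
    simp only [embVec, Finset.sum_apply, T, Pi.smul_apply, map_sum, ← hb, e, smul_eq_mul]
    refine Finset.sum_congr rfl fun i _ => ?_
    rw [Algebra.smul_def (b i), map_mul]

lemma IsLocBasis.exists_smul_mem_of_embVec_mem {g : GL (Fin r) F} (hg : IsLocBasis p L g)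
    {x : Fin r → F} (hx : embVec A F p x ∈ locCl A F p (L : Set (Fin r → F))) :
    ∃ s, s ∉ p.asIdeal ∧ s • x ∈ L := by
  refine exists_smul_mem_of_mem_span ?_
  have hx' := hg.mem_locCl_iff.1 hx
  simp only [← embGL_inv, ← embVec_vecMul, embVec, valued_algebraMap] at hx'
  let R := (p.valuation F).valuationSubring
  have hrow : ∀ i, g.1.row i ∈ Submodule.span R (L : Set (Fin r → F)) := by
    intro i
    obtain ⟨s, hs, hsL⟩ := hg.exists_smul_mem i
    have h1 := valuation_eq_one_of_notMem (F := F) hs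
    have h0 : algebraMap A F s ≠ 0 := fun h => by simp [h] at h1
    have : g.1.row i = (⟨(algebraMap A F s)⁻¹, by
        rw [Valuation.mem_valuationSubring_iff, map_inv₀, h1, inv_one]⟩ : R) • s • g.1.row i := by
      ext j
      simp only [Pi.smul_apply]
      rw [Algebra.smul_def s]
      change _ = (algebraMap A F s)⁻¹ * _
      rw [inv_mul_cancel_left₀ h0]
    rw [this]
    exact Submodule.smul_mem _ _ (Submodule.subset_span hsL)
  have : x = ∑ i, (⟨_, hx' i⟩ : R) • g.1.row i := by
    conv_lhs => rw [← vecMul_inv_vecMul g x]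
    ext j
    simp only [vecMul, dotProduct, Finset.sum_apply]
    rfl
  rw [this]
  exact Submodule.sum_mem _ fun i _ => Submodule.smul_mem _ _ (hrow i)

lemma mem_of_forall_embVec_mem (hfg : L.FG)
    (hL : Submodule.span F (L : Set (Fin r → F)) = ⊤) {x : Fin r → F}
    (hx : ∀ p : HeightOneSpectrum A, embVec A F p x ∈ locCl A F p (L : Set (Fin r → F))) :
    x ∈ L := by
  let I : Ideal A := L.comap (LinearMap.toSpanSingleton A _ x)
  have hI : ∀ a, a ∈ I ↔ a • x ∈ L := fun a => Iff.rfl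
  suffices I = ⊤ by
    simpa [hI] using (Ideal.eq_top_iff_one I).1 this
  by_contra h
  obtain ⟨m, hm, hIm⟩ := Ideal.exists_le_maximal I h
  obtain ⟨d, hd, hdx⟩ := exists_ne_zero_smul_mem hL x
  let p : HeightOneSpectrum A := ⟨m, hm.isPrime, fun h => hd (by simpa [h] using hIm hdx)⟩
  obtain ⟨g, hg⟩ := exists_isLocBasis p hfg hL
  obtain ⟨s, hs, hsx⟩ := hg.exists_smul_mem_of_embVec_mem (hx p)
  exact hs (hIm hsx)

lemma subset_locCl (p : HeightOneSpectrum A) {S : Set (Fin r → F)} {x : Fin r → F} (hx : x ∈ S) :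
    embVec A F p x ∈ locCl A F p S := subset_closure ⟨x, hx, rfl⟩

lemma mem_cosetOf_iff_forall_embVec_mem (hfg : L.FG)
    (hL : Submodule.span F (L : Set (Fin r → F)) = ⊤) (v : Fin r → F) {x : Fin r → F} :
    x ∈ cosetOf v (L : Set (Fin r → F)) ↔
      ∀ p : HeightOneSpectrum A, embVec A F p x ∈ locCl A F p (cosetOf v (L : Set (Fin r → F))) := by
  refine ⟨fun h p => subset_locCl p h, fun h => mem_of_forall_embVec_mem hfg hL fun p => ?_⟩
  have hp := h p
  rw [locCl_cosetOf] at hp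
  rwa [embVec_sub]

lemma stabSet_of_forall_stabSet_locCl (hfg : L.FG)
    (hL : Submodule.span F (L : Set (Fin r → F)) = ⊤) (v : Fin r → F) {γ : GL (Fin r) F}
    (h : ∀ p : HeightOneSpectrum A,
      StabSet (locCl A F p (cosetOf v (L : Set (Fin r → F)))) (embGL A F p γ)) :
    StabSet (cosetOf v (L : Set (Fin r → F))) γ := by
  rw [stabSet_iff]
  intro x
  rw [mem_cosetOf_iff_forall_embVec_mem hfg hL, mem_cosetOf_iff_forall_embVec_mem hfg hL]
  refine forall_congr' fun p => ?_
  rw [embVec_vecMul]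
  exact stabSet_iff.1 (h p) _

end LocalGlobal

section SpecialLinear

open SpecialLinearGroup in
lemma diag2n_eq_transvection_mul {K ι : Type*} [Field K] [Fintype ι] [DecidableEq ι] {i j : ι}
    (hij : i ≠ j) {a : K} (ha : a ≠ 0) :
    diag2n hij a ha = SpecialLinearGroup.transvection hij a *
      (SpecialLinearGroup.transvection hij.symm (-a⁻¹) * (SpecialLinearGroup.transvection hij a *
      (SpecialLinearGroup.transvection hij (-1) * (SpecialLinearGroup.transvection hij.symm 1 *
      SpecialLinearGroup.transvection hij (-1))))) := by
  refine Subtype.ext (Eq.trans ?_ (Matrix.mul_one _))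
  change diagonal _ = Matrix.transvection i j a * (Matrix.transvection j i (-a⁻¹) *
    (Matrix.transvection i j a * (Matrix.transvection i j (-1) * (Matrix.transvection j i 1 *
      Matrix.transvection i j (-1))))) * 1
  simp only [Matrix.mul_assoc]
  ext k l
  have h1 : ∀ m, Matrix.transvection i j (-1 : K) m l =
      (1 : Matrix ι ι K) m l - if m = i ∧ l = j then 1 else 0 := by
    intro m
    simp only [Matrix.transvection, Matrix.add_apply, single_apply]
    grind
  rcases eq_or_ne k i with rfl | hki
  · simp [hij, hij.symm, diagonal_apply, h1, Matrix.one_apply]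
    grind
  rcases eq_or_ne k j with rfl | hkj
  · simp [hij, hij.symm, diagonal_apply, h1, Matrix.one_apply]
    grind
  · simp [hki, hkj, diagonal_apply, h1, Matrix.one_apply]

variable {A : Type*} [CommRing A] [IsDedekindDomain A]
  {F : Type*} [Field F] [Algebra A F] [IsFractionRing A F] {r : ℕ}

lemma map_slTransvection {ι R S : Type*} [Fintype ι] [DecidableEq ι] [CommRing R] [CommRing S]
    (f : R →+* S) {i j : ι} (hij : i ≠ j) (b : R) :
    SpecialLinearGroup.map f (SpecialLinearGroup.transvection hij b) =
      SpecialLinearGroup.transvection hij (f b) := by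
  refine Subtype.ext (Matrix.ext fun k l => ?_)
  change f (Matrix.transvection i j b k l) = Matrix.transvection i j (f b) k l
  simp only [Matrix.transvection, Matrix.add_apply, Matrix.one_apply, single_apply]
  split_ifs <;> simp

lemma mulSingle_transvection {ι : Type*} [DecidableEq ι] {K : ι → Type*} [∀ i, CommRing (K i)]
    {i j : Fin r} (hij : i ≠ j) (p : ι) (a : K p) :
    Pi.mulSingle p (SpecialLinearGroup.transvection hij a) =
      fun q => SpecialLinearGroup.transvection hij (Pi.single (M := K) p a q) := by
  funext q
  rcases eq_or_ne q p with rfl | hq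
  · simp
  · simp [hq]

/-- Strong approximation for the special linear group. -/
lemma exists_specialLinearGroup_mem (hr : 2 ≤ r) (s : Finset (HeightOneSpectrum A))
    (h : ∀ p : HeightOneSpectrum A, SpecialLinearGroup (Fin r) (p.adicCompletion F))
    (U : ∀ p : HeightOneSpectrum A, Set (SpecialLinearGroup (Fin r) (p.adicCompletion F)))
    (hU : ∀ p ∈ s, U p ∈ 𝓝 (h p)) :
    ∃ γ : SpecialLinearGroup (Fin r) F,
      (∀ p ∈ s, SpecialLinearGroup.map (algebraMap F (p.adicCompletion F)) γ ∈ U p) ∧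
        ∀ p ∉ s, ∀ i j, p.valuation F (γ.1 i j) ≤ 1 := by
  classical
  have : Nontrivial (Fin r) := Fin.nontrivial_iff_two_le.2 hr
  let R := (s : Set (HeightOneSpectrum A)).integer F
  let G := ∀ p : s, SpecialLinearGroup (Fin r) (p.1.adicCompletion F)
  let φ : SpecialLinearGroup (Fin r) R →* G := MonoidHom.pi fun p =>
    (SpecialLinearGroup.map (algebraMap F (p.1.adicCompletion F))).comp
      (SpecialLinearGroup.map (algebraMap R F))
  let H : Subgroup G := φ.range.topologicalClosure
  have htrans : ∀ (p : s) {i j : Fin r} (hij : i ≠ j) (a : p.1.adicCompletion F),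
      (Pi.mulSingle p (SpecialLinearGroup.transvection hij a) : G) ∈ H := by
    intro p i j hij a
    let τ : (∀ q : s, q.1.adicCompletion F) → G := fun b q =>
      SpecialLinearGroup.transvection hij (b q)
    have hτ : Continuous τ := by
      refine continuous_pi fun q => Continuous.subtype_mk ?_ _
      refine continuous_matrix fun k l => ?_
      simp only [Matrix.transvection, Matrix.add_apply, single_apply]
      split_ifs <;> fun_prop
    have hmem : (Pi.single p a : ∀ q : s, q.1.adicCompletion F) ∈
        closure (Set.range fun (f : R) (q : s) => algebraMap F (q.1.adicCompletion F) f) := by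
      rw [mem_closure_iff_nhds]
      intro V hV
      rw [nhds_pi, Filter.mem_pi'] at hV
      obtain ⟨I, W, hW, hWV⟩ := hV
      obtain ⟨f, hf, hf'⟩ := exists_mem_and_valuation_le_one (F := F) s
        (fun q => if hq : q ∈ s then (Pi.single p a : ∀ q : s, q.1.adicCompletion F) ⟨q, hq⟩ else 0)
        (fun q => if hq : q ∈ s then W ⟨q, hq⟩ else Set.univ) (fun q hq => by
          simpa only [dif_pos hq] using hW ⟨q, hq⟩)
      refine ⟨_, hWV fun q _ => ?_, ⟨f, fun q hq => hf' q hq⟩, rfl⟩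
      simpa using hf q q.2
    rw [mulSingle_transvection (K := fun q : s => q.1.adicCompletion F)]
    refine map_mem_closure hτ hmem ?_
    rintro _ ⟨f, rfl⟩
    refine ⟨SpecialLinearGroup.transvection hij f, ?_⟩
    funext q
    exact (congrArg _ (map_slTransvection (algebraMap R F) hij f)).trans
      (map_slTransvection (algebraMap F (q.1.adicCompletion F)) hij _)
  have hH : ∀ x : G, x ∈ H := by
    refine fun x => Subgroup.pi_mem_of_mulSingle_mem x fun p => ?_
    refine SpecialLinearGroup.diagonal_transvection_induction'
      (fun g => (Pi.mulSingle p g : G) ∈ H) (x p) ?_ (fun i j hij a => htrans p hij a) ?_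
    · intro i j hij c hc
      simp only [diag2n_eq_transvection_mul, Pi.mulSingle_mul]
      exact H.mul_mem (htrans _ _ _) (H.mul_mem (htrans _ _ _) (H.mul_mem (htrans _ _ _)
        (H.mul_mem (htrans _ _ _) (H.mul_mem (htrans _ _ _) (htrans _ _ _)))))
    · intro g g' hg hg'
      rw [Pi.mulSingle_mul]
      exact H.mul_mem hg hg'
  have hx : (fun p : s => h p) ∈ closure (φ.range : Set G) := hH _
  obtain ⟨_, hmem, γ, rfl⟩ := mem_closure_iff_nhds.1 hx
    (Set.univ.pi fun p : s => U p) (set_pi_mem_nhds Set.finite_univ fun p _ => hU p p.2)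
  exact ⟨SpecialLinearGroup.map (algebraMap R F) γ, fun p hp => hmem ⟨p, hp⟩ trivial,
    fun p hp i j => (γ.1 i j).2 p hp⟩

end SpecialLinear

section LocalLattice

variable {A : Type*} [CommRing A] [IsDedekindDomain A]
  {F : Type*} [Field F] [Algebra A F] [IsFractionRing A F] {p : HeightOneSpectrum A} {r : ℕ}

/-- The lattice in `F_p^r` spanned over the valuation ring by the rows of `g`. -/
def rowLattice (g : GL (Fin r) (p.adicCompletion F)) : AddSubgroup (Fin r → p.adicCompletion F) where
  carrier := {y | ∀ i, Valued.v ((y ᵥ* (g⁻¹ : GL (Fin r) (p.adicCompletion F)).1) i) ≤ 1}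
  zero_mem' i := by simp
  add_mem' hx hy i := by
    rw [add_vecMul]
    exact Valued.v.map_add_le (hx i) (hy i)
  neg_mem' hx i := by
    rw [neg_vecMul, Pi.neg_apply, Valuation.map_neg]
    exact hx i

variable {g g' : GL (Fin r) (p.adicCompletion F)}

lemma mem_rowLattice {y : Fin r → p.adicCompletion F} : y ∈ rowLattice g ↔
    ∀ i, Valued.v ((y ᵥ* (g⁻¹ : GL (Fin r) (p.adicCompletion F)).1) i) ≤ 1 := Iff.rfl

lemma smul_mem_rowLattice {a : p.adicCompletion F} (ha : Valued.v a ≤ 1)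
    {y : Fin r → p.adicCompletion F} (hy : y ∈ rowLattice g) : a • y ∈ rowLattice g := by
  intro i
  rw [smul_vecMul, Pi.smul_apply, smul_eq_mul, map_mul]
  exact mul_le_one' ha (hy i)

lemma row_vecMul_inv (i : Fin r) :
    g.1.row i ᵥ* (g⁻¹ : GL (Fin r) (p.adicCompletion F)).1 = Pi.single i 1 := by
  have h : g.1.row i = Pi.single i 1 ᵥ* g.1 := (single_one_vecMul i g.1).symm
  rw [h, vecMul_vecMul_inv]

lemma row_mem_rowLattice (i : Fin r) : g.1.row i ∈ rowLattice g := by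
  intro j
  rw [row_vecMul_inv, Pi.single_apply]
  split_ifs <;> simp

lemma eq_sum_smul_row (y : Fin r → p.adicCompletion F) :
    y = ∑ i, (y ᵥ* (g⁻¹ : GL (Fin r) (p.adicCompletion F)).1) i • g.1.row i := by
  conv_lhs => rw [← vecMul_inv_vecMul g y]
  funext j
  simp only [vecMul, dotProduct, Finset.sum_apply]
  rfl

lemma vecMul_mem_rowLattice {k : Matrix (Fin r) (Fin r) (p.adicCompletion F)}
    (hk : ∀ i, g.1.row i ᵥ* k ∈ rowLattice g) {y : Fin r → p.adicCompletion F}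
    (hy : y ∈ rowLattice g) : y ᵥ* k ∈ rowLattice g := by
  rw [eq_sum_smul_row (g := g) y, sum_vecMul]
  refine sum_mem fun i _ => ?_
  rw [smul_vecMul]
  exact smul_mem_rowLattice (hy i) (hk i)

lemma isOpen_rowLattice : IsOpen (rowLattice g : Set (Fin r → p.adicCompletion F)) := by
  have : (rowLattice g : Set (Fin r → p.adicCompletion F)) =
      vecMulHomeomorph g⁻¹ ⁻¹' Set.univ.pi fun _ => {x | Valued.v x ≤ 1} := by
    ext y
    exact ⟨fun h i _ => h i, fun h i => h i trivial⟩
  rw [this]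
  exact (isOpen_set_pi Set.finite_univ fun _ _ => isOpen_setOf_valued_le_one).preimage
    (vecMulHomeomorph g⁻¹).continuous

lemma vecMul_mem_cosetOf_rowLattice {k : Matrix (Fin r) (Fin r) (p.adicCompletion F)}
    {w : Fin r → p.adicCompletion F} (hw : w ᵥ* k - w ∈ rowLattice g)
    (hk : ∀ i, g.1.row i ᵥ* k ∈ rowLattice g) {x : Fin r → p.adicCompletion F}
    (hx : x ∈ cosetOf w (rowLattice g : Set (Fin r → p.adicCompletion F))) :
    x ᵥ* k ∈ cosetOf w (rowLattice g : Set (Fin r → p.adicCompletion F)) := by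
  have : x ᵥ* k - w = (x - w) ᵥ* k + (w ᵥ* k - w) := by
    rw [sub_vecMul]
    abel
  change x ᵥ* k - w ∈ rowLattice g
  rw [this]
  exact add_mem (vecMul_mem_rowLattice hk hx) hw

/-- The stabilizer of a lattice coset is open in the special linear group. -/
lemma eventually_stabSet_rowLattice (w : Fin r → p.adicCompletion F) :
    ∀ᶠ k : SpecialLinearGroup (Fin r) (p.adicCompletion F) in 𝓝 1,
      StabSet (cosetOf w (rowLattice g : Set (Fin r → p.adicCompletion F)))
        (SpecialLinearGroup.toGL k) := by
  have hval : Continuous fun k : SpecialLinearGroup (Fin r) (p.adicCompletion F) => k.1 :=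
    continuous_subtype_val
  have h : ∀ᶠ k : SpecialLinearGroup (Fin r) (p.adicCompletion F) in 𝓝 1,
      w ᵥ* k.1 - w ∈ rowLattice g ∧ ∀ i, g.1.row i ᵥ* k.1 ∈ rowLattice g := by
    refine Filter.Eventually.and ?_ (Filter.eventually_all.2 fun i => ?_)
    · have hc : Continuous fun k : SpecialLinearGroup (Fin r) (p.adicCompletion F) =>
          w ᵥ* k.1 - w := by fun_prop
      refine hc.continuousAt.eventually_mem (isOpen_rowLattice.mem_nhds ?_)
      simp
    · have hc : Continuous fun k : SpecialLinearGroup (Fin r) (p.adicCompletion F) =>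
          g.1.row i ᵥ* k.1 := by fun_prop
      refine hc.continuousAt.eventually_mem (isOpen_rowLattice.mem_nhds ?_)
      simpa using row_mem_rowLattice i
  have ht : Filter.Tendsto (fun k : SpecialLinearGroup (Fin r) (p.adicCompletion F) => k⁻¹)
      (𝓝 1) (𝓝 1) := by
    simpa using (continuous_inv (G := SpecialLinearGroup (Fin r) (p.adicCompletion F))).tendsto 1
  have h' := ht.eventually h
  filter_upwards [h, h'] with k hk hk'
  refine stabSet_of_forall_mem (fun x hx => vecMul_mem_cosetOf_rowLattice hk.1 hk.2 hx)
    fun x hx => ?_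
  rw [← map_inv]
  exact vecMul_mem_cosetOf_rowLattice hk'.1 hk'.2 hx

lemma valued_det_le_one {B : Matrix (Fin r) (Fin r) (p.adicCompletion F)}
    (hB : ∀ i j, Valued.v (B i j) ≤ 1) : Valued.v B.det ≤ 1 := by
  let C : Matrix (Fin r) (Fin r) (p.adicCompletionIntegers F) := fun i j => ⟨B i j, hB i j⟩
  have : B.det = (C.det : p.adicCompletion F) :=
    ((p.adicCompletionIntegers F).subtype.map_det C).symm
  rw [this]
  exact C.det.2

lemma valued_det_le_one_of_stabSet {c : GL (Fin r) (p.adicCompletion F)}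
    (hc : StabSet (rowLattice g : Set (Fin r → p.adicCompletion F)) c) :
    Valued.v c.1.det ≤ 1 := by
  have h : (g * c * g⁻¹).1.det = c.1.det := by
    have : g.1.det * (g⁻¹ : GL (Fin r) (p.adicCompletion F)).1.det = 1 := by
      rw [← det_mul, ← Units.val_mul, mul_inv_cancel, Units.val_one, det_one]
    rw [Units.val_mul, Units.val_mul, det_mul, det_mul, mul_right_comm, this, one_mul]
  rw [← h]
  refine valued_det_le_one fun i j => ?_
  have := (stabSet_iff.1 hc _).2 (row_mem_rowLattice (g := g) i) j
  rw [vecMul_vecMul] at this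
  rw [Units.val_mul, Units.val_mul, Matrix.mul_assoc]
  exact this

end LocalLattice

section Dilation

variable {Q : Type*} [Field Q] {r : ℕ}

/-- The dilation by a prescribed factor along a line complementary to a hyperplane. -/
lemma exists_dilation {e l : Fin r → Q} (h : e ⬝ᵥ l = 1) {u : Q} (hu : u ≠ 0) :
    ∃ k : GL (Fin r) Q, (∀ x, x ᵥ* k.1 = x + ((u - 1) * (x ⬝ᵥ l)) • e) ∧
      (∀ x, x ᵥ* (k⁻¹ : GL (Fin r) Q).1 = x + ((u⁻¹ - 1) * (x ⬝ᵥ l)) • e) ∧ k.1.det = u := by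
  let B : Q → Matrix (Fin r) (Fin r) Q := fun a => 1 + vecMulVec ((a - 1) • l) e
  have hB : ∀ a x, x ᵥ* B a = x + ((a - 1) * (x ⬝ᵥ l)) • e := fun a x => by
    simp only [B, vecMul_add, vecMul_one, vecMul_vecMulVec, dotProduct_smul, smul_eq_mul]
  have hmul : ∀ a b, a * b = 1 → B a * B b = 1 := by
    intro a b hab
    refine ext_iff_vecMul.2 fun x => ?_
    rw [← vecMul_vecMul, hB, hB, vecMul_one, add_dotProduct, smul_dotProduct, h, add_assoc,
      ← add_smul, add_eq_left, smul_eq_mul]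
    convert zero_smul Q e using 2
    linear_combination (x ⬝ᵥ l) * hab
  refine ⟨⟨B u, B u⁻¹, hmul _ _ (mul_inv_cancel₀ hu), hmul _ _ (inv_mul_cancel₀ hu)⟩,
    hB u, hB u⁻¹, ?_⟩
  change (1 + vecMulVec ((u - 1) • l) e).det = u
  rw [vecMulVec_eq Unit, det_one_add_replicateCol_mul_replicateRow, dotProduct_smul, h]
  simp

end Dilation

section LocalDeterminant

variable {A : Type*} [CommRing A] [IsDedekindDomain A]
  {F : Type*} [Field F] [Algebra A F] [IsFractionRing A F] {p : HeightOneSpectrum A} {r : ℕ}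
  {g g' : GL (Fin r) (p.adicCompletion F)}

lemma exists_valued_eq_one {e : Fin r → p.adicCompletion F} (he : e ∈ rowLattice g)
    (he' : e ∉ mIdealSMul A F p (rowLattice g : Set (Fin r → p.adicCompletion F))) :
    ∃ i, Valued.v ((e ᵥ* (g⁻¹ : GL (Fin r) (p.adicCompletion F)).1) i) = 1 := by
  by_contra! h
  refine he' ?_
  rw [eq_sum_smul_row (g := g) e]
  exact AddSubgroup.sum_mem _ fun i _ =>
    AddSubgroup.subset_closure ⟨_, (he i).lt_of_ne (h i), _, row_mem_rowLattice i, rfl⟩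

lemma valued_det_eq_one_of_stabSet {c : GL (Fin r) (p.adicCompletion F)}
    (hc : StabSet (rowLattice g : Set (Fin r → p.adicCompletion F)) c) :
    Valued.v c.1.det = 1 := by
  have h1 := valued_det_le_one_of_stabSet hc
  have h2 := valued_det_le_one_of_stabSet hc.inv
  have h3 : c.1.det * (c⁻¹ : GL (Fin r) (p.adicCompletion F)).1.det = 1 := by
    rw [← det_mul, ← Units.val_mul, mul_inv_cancel, Units.val_one, det_one]
  refine le_antisymm h1 ?_
  have h4 := congrArg Valued.v h3
  rw [map_mul, map_one] at h4
  rw [← h4]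
  exact mul_le_of_le_one_right' h2

lemma exists_stabSet_rowLattice_det (hsub : rowLattice g ≤ rowLattice g')
    (hnot : ¬ (rowLattice g : Set (Fin r → p.adicCompletion F)) ⊆
      mIdealSMul A F p (rowLattice g' : Set (Fin r → p.adicCompletion F)))
    {u : p.adicCompletion F} (hu : Valued.v u = 1) :
    ∃ k : GL (Fin r) (p.adicCompletion F),
      StabSet (rowLattice g' : Set (Fin r → p.adicCompletion F)) k ∧
      StabSet (rowLattice g : Set (Fin r → p.adicCompletion F)) k ∧ k.1.det = u := by
  obtain ⟨e, he, he'⟩ := Set.not_subset.1 hnot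
  obtain ⟨i, hi⟩ := exists_valued_eq_one (hsub he) he'
  set y := (e ᵥ* (g'⁻¹ : GL (Fin r) (p.adicCompletion F)).1) i with hy
  have hy0 : y ≠ 0 := fun h => by simp [h] at hi
  have hu0 : u ≠ 0 := fun h => by simp [h] at hu
  let l : Fin r → p.adicCompletion F := fun j =>
    (g'⁻¹ : GL (Fin r) (p.adicCompletion F)).1 j i * y⁻¹
  have hl : ∀ x, x ⬝ᵥ l = (x ᵥ* (g'⁻¹ : GL (Fin r) (p.adicCompletion F)).1) i * y⁻¹ := fun x => by
    simp only [l, vecMul, dotProduct, Finset.sum_mul, mul_assoc]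
  obtain ⟨k, hk, hk', hdet⟩ := exists_dilation (e := e) (l := l)
    (by rw [hl, ← hy, mul_inv_cancel₀ hy0]) hu0
  have hcoef : ∀ a : p.adicCompletion F, Valued.v a = 1 → ∀ x ∈ rowLattice g',
      Valued.v ((a - 1) * (x ⬝ᵥ l)) ≤ 1 := by
    intro a ha x hx
    rw [map_mul, hl, map_mul, map_inv₀, hi, inv_one, mul_one]
    exact mul_le_one' (Valued.v.map_sub_le ha.le (map_one _).le) (hx i)
  have hui : Valued.v u⁻¹ = 1 := by rw [map_inv₀, hu, inv_one]
  refine ⟨k, stabSet_of_forall_mem (fun x hx => ?_) fun x hx => ?_,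
    stabSet_of_forall_mem (fun x hx => ?_) fun x hx => ?_, hdet⟩
  · rw [hk]
    exact add_mem hx (smul_mem_rowLattice (hcoef u hu x hx) (hsub he))
  · rw [hk']
    exact add_mem hx (smul_mem_rowLattice (hcoef _ hui x hx) (hsub he))
  · rw [hk]
    exact add_mem hx (smul_mem_rowLattice (hcoef u hu x (hsub hx)) he)
  · rw [hk']
    exact add_mem hx (smul_mem_rowLattice (hcoef _ hui x (hsub hx)) he)

lemma cosetOf_eq_of_mem {G : Type*} [AddGroup G] {M : AddSubgroup G} {w : G} (hw : w ∈ M) :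
    cosetOf w (M : Set G) = M := by
  ext x
  exact ⟨fun h => by simpa using M.add_mem h hw, fun h => M.sub_mem h hw⟩

lemma exists_stabSet_det_mul_eq_one {w w' : Fin r → p.adicCompletion F}
    (ha : cosetOf w (rowLattice g : Set (Fin r → p.adicCompletion F)) ⊆
      cosetOf w' (rowLattice g' : Set (Fin r → p.adicCompletion F)))
    (hb : w ∉ rowLattice g → cosetOf w (rowLattice g : Set (Fin r → p.adicCompletion F)) =
      cosetOf w' (rowLattice g' : Set (Fin r → p.adicCompletion F)))
    (hnot : ¬ (rowLattice g : Set (Fin r → p.adicCompletion F)) ⊆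
      mIdealSMul A F p (rowLattice g' : Set (Fin r → p.adicCompletion F)))
    {c : GL (Fin r) (p.adicCompletion F)}
    (hc : StabSet (cosetOf w' (rowLattice g' : Set (Fin r → p.adicCompletion F))) c) :
    ∃ k : GL (Fin r) (p.adicCompletion F),
      StabSet (cosetOf w' (rowLattice g' : Set (Fin r → p.adicCompletion F))) k ∧
      StabSet (cosetOf w (rowLattice g : Set (Fin r → p.adicCompletion F))) k ∧
      (k * c).1.det = 1 := by
  by_cases hw : w ∈ rowLattice g
  · rw [cosetOf_eq_of_mem hw] at ha ⊢
    have hw' : w' ∈ rowLattice g' := by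
      have := ha (zero_mem (rowLattice g))
      rw [cosetOf, Set.mem_ofPred_eq, zero_sub] at this
      exact neg_mem_iff.1 this
    rw [cosetOf_eq_of_mem hw'] at ha hc ⊢
    have hv := valued_det_eq_one_of_stabSet hc
    have h0 : c.1.det ≠ 0 := fun h => by simp [h] at hv
    obtain ⟨k, hk', hk, hdet⟩ := exists_stabSet_rowLattice_det ha hnot (u := c.1.det⁻¹)
      (by rw [map_inv₀, hv, inv_one])
    refine ⟨k, hk', hk, ?_⟩
    rw [Units.val_mul, det_mul, hdet, inv_mul_cancel₀ h0]
  · rw [hb hw]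
    exact ⟨c⁻¹, hc.inv, hc.inv, by simp⟩

/-- Every coset of the stabilizer of two nested lattice cosets contains the elements of a
nonempty open subset of the special linear group. -/
lemma exists_mem_nhds_stabSet {w w' : Fin r → p.adicCompletion F}
    (ha : cosetOf w (rowLattice g : Set (Fin r → p.adicCompletion F)) ⊆
      cosetOf w' (rowLattice g' : Set (Fin r → p.adicCompletion F)))
    (hb : w ∉ rowLattice g → cosetOf w (rowLattice g : Set (Fin r → p.adicCompletion F)) =
      cosetOf w' (rowLattice g' : Set (Fin r → p.adicCompletion F)))
    (hnot : ¬ (rowLattice g : Set (Fin r → p.adicCompletion F)) ⊆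
      mIdealSMul A F p (rowLattice g' : Set (Fin r → p.adicCompletion F)))
    {c : GL (Fin r) (p.adicCompletion F)}
    (hc : StabSet (cosetOf w' (rowLattice g' : Set (Fin r → p.adicCompletion F))) c) :
    ∃ h : SpecialLinearGroup (Fin r) (p.adicCompletion F), ∀ᶠ γ in 𝓝 h,
      ∃ k : GL (Fin r) (p.adicCompletion F),
        (StabSet (cosetOf w' (rowLattice g' : Set (Fin r → p.adicCompletion F))) k ∧
          StabSet (cosetOf w (rowLattice g : Set (Fin r → p.adicCompletion F))) k) ∧
        SpecialLinearGroup.toGL γ = k * c := by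
  obtain ⟨k, hk', hk, hdet⟩ := exists_stabSet_det_mul_eq_one ha hb hnot hc
  let h : SpecialLinearGroup (Fin r) (p.adicCompletion F) := ⟨(k * c).1, hdet⟩
  have hh : SpecialLinearGroup.toGL h = k * c := Units.ext rfl
  refine ⟨h, ?_⟩
  have ht : Filter.Tendsto (fun γ : SpecialLinearGroup (Fin r) (p.adicCompletion F) => γ * h⁻¹)
      (𝓝 h) (𝓝 1) := by
    simpa using (continuous_mul_const h⁻¹).tendsto h
  filter_upwards [ht.eventually (eventually_stabSet_rowLattice (g := g') w'),
    ht.eventually (eventually_stabSet_rowLattice (g := g) w)] with γ h1 h2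
  refine ⟨SpecialLinearGroup.toGL (γ * h⁻¹) * k, ⟨h1.mul hk', h2.mul hk⟩, ?_⟩
  rw [mul_assoc, ← hh, ← map_mul, inv_mul_cancel_right]

end LocalDeterminant

section StrongApproximation

variable {A : Type*} [CommRing A] [IsDedekindDomain A]
  {F : Type*} [Field F] [Algebra A F] [IsFractionRing A F] {p : HeightOneSpectrum A} {r : ℕ}
  {L L' : Submodule A (Fin r → F)}

lemma IsLocBasis.locCl_eq {g : GL (Fin r) F} (hg : IsLocBasis p L g) :
    locCl A F p (L : Set (Fin r → F)) = rowLattice (embGL A F p g) :=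
  Set.ext fun _ => hg.mem_locCl_iff

/-- A lattice agrees with the standard one at almost all primes. -/
lemma finite_setOf_not_isLocBasis_one (hfg : L.FG)
    (hL : Submodule.span F (L : Set (Fin r → F)) = ⊤) :
    {p : HeightOneSpectrum A | ¬ IsLocBasis p L 1}.Finite := by
  obtain ⟨S, rfl⟩ := hfg
  choose d hd hdL using fun i : Fin r =>
    exists_ne_zero_smul_mem hL ((1 : GL (Fin r) F).1.row i)
  have h1 : (⋃ x ∈ S, ⋃ i : Fin r, HeightOneSpectrum.Support A (x i)).Finite :=
    S.finite_toSet.biUnion fun x _ =>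
      Set.finite_iUnion fun i => HeightOneSpectrum.Support.finite A (x i)
  have h2 : (⋃ i, {p : HeightOneSpectrum A | d i ∈ p.asIdeal}).Finite :=
    Set.finite_iUnion fun i => finite_setOf_mem_asIdeal (hd i)
  refine (h1.union h2).subset fun p hp => ?_
  by_contra hcon
  simp only [Set.mem_union, Set.mem_iUnion, not_or, not_exists] at hcon
  obtain ⟨hS, hdp⟩ := hcon
  refine hp ⟨fun x hx i => ?_, fun i => ⟨d i, hdp i, hdL i⟩⟩
  rw [inv_one, Units.val_one, vecMul_one]
  induction hx using Submodule.span_induction with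
  | mem x hx => exact not_lt.1 (hS x hx i)
  | zero => simp
  | add x y _ _ hx hy => exact (p.valuation F).map_add_le hx hy
  | smul a x _ hx =>
    rw [Pi.smul_apply, Algebra.smul_def, map_mul]
    exact mul_le_one' (p.valuation_le_one a) hx

lemma mem_rowLattice_one {y : Fin r → p.adicCompletion F} :
    y ∈ rowLattice (1 : GL (Fin r) (p.adicCompletion F)) ↔ ∀ i, Valued.v (y i) ≤ 1 := by
  simp [mem_rowLattice]

lemma stabSet_rowLattice_one {h : SpecialLinearGroup (Fin r) (p.adicCompletion F)}
    (hh : ∀ i j, Valued.v (h.1 i j) ≤ 1) :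
    StabSet (rowLattice (1 : GL (Fin r) (p.adicCompletion F)) :
      Set (Fin r → p.adicCompletion F)) (SpecialLinearGroup.toGL h) := by
  have key : ∀ k : SpecialLinearGroup (Fin r) (p.adicCompletion F),
      (∀ i j, Valued.v (k.1 i j) ≤ 1) → ∀ y ∈ rowLattice (1 : GL (Fin r) (p.adicCompletion F)),
      y ᵥ* k.1 ∈ rowLattice (1 : GL (Fin r) (p.adicCompletion F)) := by
    intro k hk y hy
    refine vecMul_mem_rowLattice (fun i => mem_rowLattice_one.2 fun j => ?_) hy
    rw [Units.val_one, show (1 : Matrix (Fin r) (Fin r) (p.adicCompletion F)).row i =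
      Pi.single i 1 from funext fun j => by simp [Matrix.one_apply, Pi.single_apply, eq_comm],
      single_one_vecMul]
    exact hk i j
  refine stabSet_of_forall_mem (key h hh) ?_
  rw [← map_inv]
  refine key h⁻¹ fun i j => ?_
  change Valued.v (adjugate h.1 i j) ≤ 1
  rw [adjugate_apply]
  refine valued_det_le_one fun k l => ?_
  rw [updateRow_apply]
  split_ifs
  · rw [Pi.single_apply]
    split_ifs <;> simp
  · exact hh k l

lemma locCl_cosetOf_eq_rowLattice_one (hL : IsLocBasis p L 1) {w : Fin r → F}
    (hw : ∀ i, p.valuation F (w i) ≤ 1) :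
    locCl A F p (cosetOf w (L : Set (Fin r → F))) =
      rowLattice (1 : GL (Fin r) (p.adicCompletion F)) := by
  have h1 : embGL A F p (1 : GL (Fin r) F) = 1 := map_one _
  rw [locCl_cosetOf, hL.locCl_eq, h1]
  refine cosetOf_eq_of_mem (mem_rowLattice_one.2 fun i => ?_)
  rw [embVec, valued_algebraMap]
  exact hw i

lemma exists_stabSet_embGL_eq_mul (hr : 2 ≤ r) (hfg : L.FG)
    (hL : Submodule.span F (L : Set (Fin r → F)) = ⊤) (hfg' : L'.FG)
    (hL' : Submodule.span F (L' : Set (Fin r → F)) = ⊤) {w w' : Fin r → F}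
    (ha : ∀ p : HeightOneSpectrum A, locCl A F p (cosetOf w (L : Set (Fin r → F))) ⊆
      locCl A F p (cosetOf w' (L' : Set (Fin r → F))))
    (hb : ∀ p : HeightOneSpectrum A, embVec A F p w ∉ locCl A F p (L : Set (Fin r → F)) →
      locCl A F p (cosetOf w (L : Set (Fin r → F))) =
        locCl A F p (cosetOf w' (L' : Set (Fin r → F))))
    (hnot : ∀ p : HeightOneSpectrum A, ¬ locCl A F p (L : Set (Fin r → F)) ⊆
      mIdealSMul A F p (locCl A F p (L' : Set (Fin r → F))))
    (c : ∀ p : HeightOneSpectrum A, GL (Fin r) (p.adicCompletion F))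
    (hc : ∀ p, StabSet (locCl A F p (cosetOf w' (L' : Set (Fin r → F)))) (c p)) :
    ∃ γ : GL (Fin r) F, StabSet (cosetOf w' (L' : Set (Fin r → F))) γ ∧
      ∀ p : HeightOneSpectrum A, ∃ k : GL (Fin r) (p.adicCompletion F),
        (StabSet (locCl A F p (cosetOf w' (L' : Set (Fin r → F)))) k ∧
          StabSet (locCl A F p (cosetOf w (L : Set (Fin r → F)))) k) ∧
        embGL A F p γ = k * c p := by
  let P : ∀ p : HeightOneSpectrum A, SpecialLinearGroup (Fin r) (p.adicCompletion F) → Prop :=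
    fun p γ => ∃ k : GL (Fin r) (p.adicCompletion F),
      (StabSet (locCl A F p (cosetOf w' (L' : Set (Fin r → F)))) k ∧
        StabSet (locCl A F p (cosetOf w (L : Set (Fin r → F)))) k) ∧
      SpecialLinearGroup.toGL γ = k * c p
  have hloc : ∀ p, ∃ h, ∀ᶠ γ in 𝓝 h, P p γ := by
    intro p
    obtain ⟨g, hg⟩ := exists_isLocBasis p hfg hL
    obtain ⟨g', hg'⟩ := exists_isLocBasis p hfg' hL'
    have ha := ha p
    have hb := hb p
    have hnot := hnot p
    have hc := hc p
    simp only [P]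
    rw [locCl_cosetOf, locCl_cosetOf, hg.locCl_eq, hg'.locCl_eq] at *
    exact exists_mem_nhds_stabSet ha hb hnot hc
  choose h hP using hloc
  have hfin : ({p : HeightOneSpectrum A | ¬ IsLocBasis p L 1} ∪
      {p : HeightOneSpectrum A | ¬ IsLocBasis p L' 1} ∪
      ((⋃ i, HeightOneSpectrum.Support A (w i)) ∪
        ⋃ i, HeightOneSpectrum.Support A (w' i))).Finite :=
    ((finite_setOf_not_isLocBasis_one hfg hL).union
      (finite_setOf_not_isLocBasis_one hfg' hL')).union
      ((Set.finite_iUnion fun i => HeightOneSpectrum.Support.finite A (w i)).union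
        (Set.finite_iUnion fun i => HeightOneSpectrum.Support.finite A (w' i)))
  obtain ⟨γ, hγ, hγ'⟩ := exists_specialLinearGroup_mem hr hfin.toFinset h
    (fun p => {γ | P p γ}) fun p _ => hP p
  have hall : ∀ p, P p (SpecialLinearGroup.map (algebraMap F (p.adicCompletion F)) γ) := by
    intro p
    by_cases hp : p ∈ hfin.toFinset
    · exact hγ p hp
    have hint := hγ' p hp
    simp only [Set.Finite.mem_toFinset, Set.mem_union, Set.mem_iUnion, not_or, not_exists,
      Set.mem_ofPred_eq, not_not] at hp
    obtain ⟨⟨hp, hp'⟩, hw, hw'⟩ := hp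
    have hS := locCl_cosetOf_eq_rowLattice_one hp fun i => not_lt.1 (hw i)
    have hS' := locCl_cosetOf_eq_rowLattice_one hp' fun i => not_lt.1 (hw' i)
    have hcp := hc p
    have hs := stabSet_rowLattice_one
      (h := SpecialLinearGroup.map (algebraMap F (p.adicCompletion F)) γ) fun i j => by
        rw [SpecialLinearGroup.map_apply_coe, RingHom.mapMatrix_apply, map_apply,
          valued_algebraMap]
        exact hint i j
    simp only [P]
    rw [hS'] at hcp
    rw [hS, hS']
    exact ⟨_, ⟨hs.mul hcp.inv, hs.mul hcp.inv⟩, (inv_mul_cancel_right _ _).symm⟩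
  refine ⟨SpecialLinearGroup.toGL γ, stabSet_of_forall_stabSet_locCl hfg' hL' w' fun p => ?_,
    fun p => ?_⟩
  all_goals
    obtain ⟨k, hk, hkc⟩ := hall p
    have he : embGL A F p (SpecialLinearGroup.toGL γ) = k * c p := by
      rw [← hkc]
      exact Units.ext rfl
  · rw [he]
    exact hk.1.mul (hc p)
  · exact ⟨k, hk, he⟩

end StrongApproximation

section Image

variable {A : Type*} [CommRing A] {F : Type*} [Field F] [Algebra A F] {r : ℕ}

/-- The image of a submodule of `F^r` under right multiplication by an invertible matrix. -/
def mapVecMul (L : Submodule A (Fin r → F)) (δ : GL (Fin r) F) : Submodule A (Fin r → F) :=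
  L.map (δ.1.vecMulLinear.restrictScalars A)

lemma coe_mapVecMul (L : Submodule A (Fin r → F)) (δ : GL (Fin r) F) :
    (mapVecMul L δ : Set (Fin r → F)) = (fun x => x ᵥ* δ.1) '' (L : Set (Fin r → F)) := rfl

lemma span_mapVecMul {L : Submodule A (Fin r → F)} (δ : GL (Fin r) F)
    (hL : Submodule.span F (L : Set (Fin r → F)) = ⊤) :
    Submodule.span F (mapVecMul L δ : Set (Fin r → F)) = ⊤ := by
  have h : (mapVecMul L δ : Set (Fin r → F)) = δ.1.vecMulLinear '' (L : Set (Fin r → F)) := rfl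
  rw [h, Submodule.span_image, hL, Submodule.map_top, LinearMap.range_eq_top]
  exact fun x => ⟨_, vecMul_inv_vecMul δ x⟩

variable [IsDedekindDomain A] [IsFractionRing A F]

lemma image_embGL_cosetOf (p : HeightOneSpectrum A) (v : Fin r → F)
    (L : Submodule A (Fin r → F)) (δ : GL (Fin r) F) :
    (fun x => x ᵥ* (embGL A F p δ).1) '' cosetOf (embVec A F p v)
        (locCl A F p (L : Set (Fin r → F))) =
      locCl A F p (cosetOf (v ᵥ* δ.1) (mapVecMul L δ : Set (Fin r → F))) := by
  rw [← locCl_cosetOf, ← locCl_image_vecMul, image_vecMul_cosetOf, coe_mapVecMul]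

lemma embVec_vecMul_mem_locCl_mapVecMul (p : HeightOneSpectrum A) {v : Fin r → F}
    {L : Submodule A (Fin r → F)} {δ : GL (Fin r) F}
    (h : embVec A F p v ∈ locCl A F p (L : Set (Fin r → F))) :
    embVec A F p (v ᵥ* δ.1) ∈ locCl A F p (mapVecMul L δ : Set (Fin r → F)) := by
  rw [coe_mapVecMul, locCl_image_vecMul, embVec_vecMul]
  exact ⟨_, h, rfl⟩

lemma exists_stabSet_iff_forall_exists_stabSet {L L' : Submodule A (Fin r → F)} (hfg : L.FG)
    (hL : Submodule.span F (L : Set (Fin r → F)) = ⊤) (hfg' : L'.FG)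
    (hL' : Submodule.span F (L' : Set (Fin r → F)) = ⊤) (w w' : Fin r → F)
    (γ₁ γ₂ : GL (Fin r) F) :
    (∃ g : GL (Fin r) F, (StabSet (cosetOf w' (L' : Set (Fin r → F))) g ∧
        StabSet (cosetOf w (L : Set (Fin r → F))) g) ∧ γ₁ = g * γ₂) ↔
      ∀ p : HeightOneSpectrum A, ∃ k : GL (Fin r) (p.adicCompletion F),
        (StabSet (locCl A F p (cosetOf w' (L' : Set (Fin r → F)))) k ∧
          StabSet (locCl A F p (cosetOf w (L : Set (Fin r → F)))) k) ∧
        embGL A F p γ₁ = k * embGL A F p γ₂ := by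
  constructor
  · rintro ⟨g, ⟨h', h⟩, rfl⟩ p
    exact ⟨embGL A F p g, ⟨h'.locCl p, h.locCl p⟩, embGL_mul p g γ₂⟩
  · intro h
    have key : ∀ p, StabSet (locCl A F p (cosetOf w' (L' : Set (Fin r → F))))
          (embGL A F p (γ₁ * γ₂⁻¹)) ∧
        StabSet (locCl A F p (cosetOf w (L : Set (Fin r → F)))) (embGL A F p (γ₁ * γ₂⁻¹)) := by
      intro p
      obtain ⟨k, hk, hkγ⟩ := h p
      rwa [embGL_mul, embGL_inv, hkγ, mul_inv_cancel_right]
    exact ⟨γ₁ * γ₂⁻¹, ⟨stabSet_of_forall_stabSet_locCl hfg' hL' w' fun p => (key p).1,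
      stabSet_of_forall_stabSet_locCl hfg hL w fun p => (key p).2⟩,
      (inv_mul_cancel_right _ _).symm⟩

end Image

/-- Lemma 14.3: the natural map `Γ∖Γ′ → ∏_p K_p∖K′_p` is well defined and
bijective. -/
theorem gamma_coset_bijection
    (Fq : Type*) [Field Fq] [Fintype Fq]
    (F : Type*) [Field F] [Algebra (RatFunc Fq) F] [FiniteDimensional (RatFunc Fq) F]
    [Algebra (Polynomial Fq) F] [IsScalarTower (Polynomial Fq) (RatFunc Fq) F]
    [IsDedekindDomain ↥(integralClosure (Polynomial Fq) F)]
    [IsFractionRing ↥(integralClosure (Polynomial Fq) F) F]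
    (r : ℕ) (hr : 2 ≤ r)
    (L L' : Submodule ↥(integralClosure (Polynomial Fq) F) (Fin r → F))
    (hLfg : L.FG) (hL'fg : L'.FG)
    (hLspan : Submodule.span F (L : Set (Fin r → F)) = ⊤)
    (hL'span : Submodule.span F (L' : Set (Fin r → F)) = ⊤)
    (v0 v0' : Fin r → F) (δ : GL (Fin r) F)
    -- (a): `vδ + L_pδ ⊆ v′ + L′_p`
    (hA : ∀ p : HeightOneSpectrum ↥(integralClosure (Polynomial Fq) F),
      (fun x => Matrix.vecMul x
          ((embGL _ F p δ : GL (Fin r) (p.adicCompletion F)) :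
            Matrix (Fin r) (Fin r) (p.adicCompletion F))) ''
          cosetOf (embVec _ F p v0) (locCl _ F p (L : Set (Fin r → F))) ⊆
        cosetOf (embVec _ F p v0') (locCl _ F p (L' : Set (Fin r → F))))
    -- (b): equality whenever `v ∉ L_p`
    (hB : ∀ p : HeightOneSpectrum ↥(integralClosure (Polynomial Fq) F),
      embVec _ F p v0 ∉ locCl _ F p (L : Set (Fin r → F)) →
      (fun x => Matrix.vecMul x
          ((embGL _ F p δ : GL (Fin r) (p.adicCompletion F)) :
            Matrix (Fin r) (Fin r) (p.adicCompletion F))) ''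
          cosetOf (embVec _ F p v0) (locCl _ F p (L : Set (Fin r → F))) =
        cosetOf (embVec _ F p v0') (locCl _ F p (L' : Set (Fin r → F))))
    -- (c): `L_pδ ⊄ 𝔪_p L′_p`
    (hC : ∀ p : HeightOneSpectrum ↥(integralClosure (Polynomial Fq) F),
      ¬ ((fun x => Matrix.vecMul x
          ((embGL _ F p δ : GL (Fin r) (p.adicCompletion F)) :
            Matrix (Fin r) (Fin r) (p.adicCompletion F))) ''
          locCl _ F p (L : Set (Fin r → F)) ⊆
        mIdealSMul _ F p (locCl _ F p (L' : Set (Fin r → F))))) :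
    -- (1) well-definedness of the target: images of elements of `Γ′` lie in `K′_p`
    (∀ γ : GL (Fin r) F, StabSet (cosetOf v0' (L' : Set (Fin r → F))) γ →
      ∀ p : HeightOneSpectrum ↥(integralClosure (Polynomial Fq) F),
        StabSet (cosetOf (embVec _ F p v0') (locCl _ F p (L' : Set (Fin r → F))))
          (embGL _ F p γ)) ∧
    -- (2) the map is well defined and injective on cosets
    (∀ γ1 γ2 : GL (Fin r) F, StabSet (cosetOf v0' (L' : Set (Fin r → F))) γ1 →
      StabSet (cosetOf v0' (L' : Set (Fin r → F))) γ2 →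
      ((∃ g : GL (Fin r) F, (StabSet (cosetOf v0' (L' : Set (Fin r → F))) g ∧
          StabSet ((fun x => Matrix.vecMul x (δ : Matrix (Fin r) (Fin r) F)) ''
            cosetOf v0 (L : Set (Fin r → F))) g) ∧ γ1 = g * γ2) ↔
        (∀ p : HeightOneSpectrum ↥(integralClosure (Polynomial Fq) F),
          ∃ kk : GL (Fin r) (p.adicCompletion F),
            (StabSet (cosetOf (embVec _ F p v0') (locCl _ F p (L' : Set (Fin r → F)))) kk ∧
             StabSet ((fun x => Matrix.vecMul x
                 ((embGL _ F p δ : GL (Fin r) (p.adicCompletion F)) :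
                   Matrix (Fin r) (Fin r) (p.adicCompletion F))) ''
                 cosetOf (embVec _ F p v0) (locCl _ F p (L : Set (Fin r → F)))) kk) ∧
            embGL _ F p γ1 = kk * embGL _ F p γ2))) ∧
    -- (3) surjectivity
    (∀ c : (p : HeightOneSpectrum ↥(integralClosure (Polynomial Fq) F)) →
        GL (Fin r) (p.adicCompletion F),
      (∀ p, StabSet (cosetOf (embVec _ F p v0') (locCl _ F p (L' : Set (Fin r → F)))) (c p)) →
      ∃ γ : GL (Fin r) F, StabSet (cosetOf v0' (L' : Set (Fin r → F))) γ ∧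
        ∀ p : HeightOneSpectrum ↥(integralClosure (Polynomial Fq) F),
          ∃ kk : GL (Fin r) (p.adicCompletion F),
            (StabSet (cosetOf (embVec _ F p v0') (locCl _ F p (L' : Set (Fin r → F)))) kk ∧
             StabSet ((fun x => Matrix.vecMul x
                 ((embGL _ F p δ : GL (Fin r) (p.adicCompletion F)) :
                   Matrix (Fin r) (Fin r) (p.adicCompletion F))) ''
                 cosetOf (embVec _ F p v0) (locCl _ F p (L : Set (Fin r → F)))) kk) ∧
            embGL _ F p γ = kk * c p) := by
  have hNfg : (mapVecMul L δ).FG := hLfg.map _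
  have hNspan := span_mapVecMul δ hLspan
  have hC' : ∀ p : HeightOneSpectrum ↥(integralClosure (Polynomial Fq) F),
      ¬ locCl _ F p (mapVecMul L δ : Set (Fin r → F)) ⊆
      mIdealSMul _ F p (locCl _ F p (L' : Set (Fin r → F))) := fun p => by
    rw [coe_mapVecMul, locCl_image_vecMul]
    exact hC p
  simp only [image_embGL_cosetOf] at hA hB ⊢
  simp only [← locCl_cosetOf] at hA hB
  simp only [← locCl_cosetOf, image_vecMul_cosetOf, ← coe_mapVecMul]
  refine ⟨fun γ hγ p => hγ.locCl p, fun γ₁ γ₂ _ _ => ?_, ?_⟩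
  · exact exists_stabSet_iff_forall_exists_stabSet hNfg hNspan hL'fg hL'span _ _ γ₁ γ₂
  · exact exists_stabSet_embGL_eq_mul hr hNfg hNspan hL'fg hL'span hA
      (fun p hp => hB p fun h => hp (embVec_vecMul_mem_locCl_mapVecMul p h)) hC'
end
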